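/- Let A be a unital C*-algebra with complexity rank at most one. Then K₁(A) is torsion-free; concretely: for every m ≥ 1, every unitary u ∈ M_m(A), and every integer n ≥ 1, if there exists r ≥ 0 such that the block-diagonal unitary diag(u, u, …, u, 1_r) ∈ M_{nm+r}(A) (with n copies of u and an r×r identity block) is connected to the identity 1_{nm+r} by a continuous path of unitaries in M_{nm+r}(A), then there exists s ≥ 0 such that diag(u, 1_s) ∈ M_{m+s}(A) is connected to the identity 1_{m+s} by a continuous path of unitaries in M_{m+s}(A). -/

import Mathlib

universe u

/-- `a ∈_ε S`: there is `s ∈ S` with `‖a - s‖ < ε`. -/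
def MemEps {A : Type u} [CStarAlgebra A] (ε : ℝ) (S : Set A) (a : A) : Prop :=
  ∃ s ∈ S, ‖a - s‖ < ε

/-- `S ⊆_ε T`. -/
def SubsetEps {A : Type u} [CStarAlgebra A] (ε : ℝ) (S T : Set A) : Prop :=
  ∀ s ∈ S, ‖s‖ ≤ 1 → ∃ t ∈ T, ‖t‖ ≤ 1 ∧ ‖s - t‖ < ε

/-- A unital C*-algebra `A` decomposes over a class `𝒞` of C*-subalgebras of `A`
(Definition 2.3 of the paper). -/
def Decomposes (A : Type u) [CStarAlgebra A]
    (𝒞 : NonUnitalStarSubalgebra ℂ A → Prop) : Prop :=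
  ∀ (X : Finset A) (ε : ℝ), 0 < ε →
    ∃ C D E : NonUnitalStarSubalgebra ℂ A, 𝒞 C ∧ 𝒞 D ∧ 𝒞 E ∧
      ∃ h : A, (∃ x : A, h = star x * x) ∧ ‖h‖ ≤ 1 ∧
        (∀ x ∈ X, ‖h * x - x * h‖ < ε) ∧
        (∀ x ∈ X, MemEps ε (C : Set A) (h * x)) ∧
        (∀ x ∈ X, MemEps ε (D : Set A) ((1 - h) * x)) ∧
        (∀ x ∈ X, MemEps ε (E : Set A) (h * ((1 - h) * x))) ∧
        SubsetEps ε (E : Set A) (C : Set A) ∧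
        SubsetEps ε (E : Set A) (D : Set A) ∧
        (∀ e ∈ E, ‖e‖ ≤ 1 → MemEps ε (E : Set A) (h * e))

/-- A C*-subalgebra of `A` which is a unital, locally finite-dimensional C*-algebra in its
own right: the class `D₀` of the complexity hierarchy, as a predicate on C*-subalgebras. -/
def IsUnitalLocFinDimSub {A : Type u} [CStarAlgebra A]
    (S : NonUnitalStarSubalgebra ℂ A) : Prop :=
  IsClosed (S : Set A) ∧
  (∃ e ∈ S, ∀ x ∈ S, e * x = x ∧ x * e = x) ∧
  (∀ (Y : Finset A), (↑Y : Set A) ⊆ (S : Set A) → ∀ δ : ℝ, 0 < δ →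
    ∃ G : NonUnitalStarSubalgebra ℂ A, G ≤ S ∧ FiniteDimensional ℂ G ∧
      ∀ y ∈ Y, MemEps δ (G : Set A) y)

/-- A unital C*-algebra has complexity rank at most one iff it decomposes over the class
`D₀` of unital locally finite-dimensional C*-algebras. -/
def ComplexityRankLeOne (A : Type u) [CStarAlgebra A] : Prop :=
  Decomposes A (IsUnitalLocFinDimSub (A := A))

/-- The set of unitary elements of a matrix algebra over a C*-algebra. -/
def MatUnitary {A : Type u} [CStarAlgebra A] (ι : Type) [Fintype ι] [DecidableEq ι] :
    Set (Matrix ι ι A) :=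
  {v | star v * v = 1 ∧ v * star v = 1}

namespace K1

/-- `(x* x)^{-1/2}` -/
noncomputable def invAbs {R : Type*} [CStarAlgebra R] (x : R) : R :=
  cfc (fun t : ℝ => (Real.sqrt t)⁻¹) (star x * x)

lemma spec_pos {R : Type*} [CStarAlgebra R] {x : R} (hx : IsUnit x) :
    spectrum ℝ (star x * x) ⊆ Set.Ioi 0 := by
  intro t ht
  have h0 : 0 ≤ t := spectrum_star_mul_self_nonneg t ht
  rcases h0.eq_or_lt with h | h
  · exfalso
    subst h
    have : IsUnit (star x * x) := (hx.star).mul hx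
    exact (spectrum.zero_notMem_iff ℝ).2 this ht
  · exact h

lemma cont_invsqrt : ContinuousOn (fun t : ℝ => (Real.sqrt t)⁻¹) (Set.Ioi 0) := by
  apply ContinuousOn.inv₀
  · exact Real.continuous_sqrt.continuousOn
  · intro t ht
    exact (Real.sqrt_pos.2 ht).ne'

lemma invAbs_sa {R : Type*} [CStarAlgebra R] (x : R) : star (invAbs x) = invAbs x := by
  have : IsSelfAdjoint (invAbs x) := cfc_predicate _ _
  exact this

lemma invAbs_sq {R : Type*} [CStarAlgebra R] {x : R} (hx : IsUnit x) :
    invAbs x * (star x * x) * invAbs x = 1 := by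
  have hc : ContinuousOn (fun t : ℝ => (Real.sqrt t)⁻¹) (spectrum ℝ (star x * x)) :=
    cont_invsqrt.mono (spec_pos hx)
  have hsa : IsSelfAdjoint (star x * x) := .star_mul_self x
  unfold invAbs
  conv_lhs => enter [1, 2]; rw [← cfc_id' ℝ (star x * x)]
  rw [← cfc_mul _ _ _ hc, ← cfc_mul _ _ _ (by fun_prop) hc]
  rw [← cfc_one ℝ (star x * x)]
  apply cfc_congr
  intro t ht
  have h1 : 0 < t := spec_pos hx ht
  have h2 := Real.sqrt_pos.2 h1
  have h3 := Real.mul_self_sqrt h1.le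
  simp only [Pi.one_apply]
  field_simp
  linarith

lemma invAbs_comm {R : Type*} [CStarAlgebra R] (x : R) {q : R} (hq : Commute (star x * x) q) :
    Commute (invAbs x) q := by
  unfold invAbs
  exact hq.cfc_real _

/-- the unitary part -/
noncomputable def pol {R : Type*} [CStarAlgebra R] (x : R) : R := x * invAbs x

lemma pol_unitary {R : Type*} [CStarAlgebra R] {x : R} (hx : IsUnit x) :
    star (pol x) * pol x = 1 ∧ pol x * star (pol x) = 1 := by
  have h1 : star (pol x) * pol x = 1 := by
    have := invAbs_sq hx
    simp only [pol, star_mul, invAbs_sa]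
    rw [← this]; noncomm_ring
  refine ⟨h1, ?_⟩
  have hk : IsUnit (invAbs x) := by
    have hsa : Commute (invAbs x) (star x * x) := invAbs_comm x rfl
    have h := invAbs_sq hx
    refine ⟨⟨invAbs x, star x * x * invAbs x, by rw [← mul_assoc]; exact h, ?_⟩, rfl⟩
    rw [← h, hsa.eq]
  have hp : IsUnit (pol x) := hx.mul hk
  obtain ⟨v, hv⟩ := hp
  rw [← hv] at h1 ⊢
  have : star (v : R) = ((v⁻¹ : Rˣ) : R) := by
    calc star (v : R) = star (v : R) * (v * ((v⁻¹ : Rˣ) : R)) := by simp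
    _ = ((v⁻¹ : Rˣ) : R) := by rw [← mul_assoc, h1, one_mul]
  rw [this]; simp

lemma cfc_invsqrt_one {R : Type*} [CStarAlgebra R] :
    cfc (fun t : ℝ => (Real.sqrt t)⁻¹) (1 : R) = 1 := by
  have h := cfc_algebraMap (1 : ℝ) (fun t : ℝ => (Real.sqrt t)⁻¹) (A := R)
  simpa using h

lemma pol_of_unitary {R : Type*} [CStarAlgebra R] {x : R} (hx : star x * x = 1) : pol x = x := by
  unfold pol invAbs
  rw [hx, cfc_invsqrt_one]
  simp

lemma joined_unitary {R : Type*} [CStarAlgebra R] {x : R} (hx : star x * x = 1)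
    (h : JoinedIn {y : R | IsUnit y} x 1) :
    JoinedIn {y : R | star y * y = 1 ∧ y * star y = 1} x 1 := by
  obtain ⟨γ, hγ⟩ := h
  have hc : Continuous (fun t => pol (γ t)) := by
    unfold pol invAbs
    refine γ.continuous.mul ?_
    refine Continuous.cfc_of_mem_nhdsSet (s := Set.Ioi 0) _ ?_ ?_ ?_ cont_invsqrt
    · rw [isOpen_Ioi.mem_nhdsSet]
      exact Set.iUnion_subset fun t => spec_pos (hγ t)
    · exact (γ.continuous.star).mul γ.continuous
    · intro t; exact IsSelfAdjoint.star_mul_self _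
  refine ⟨⟨⟨fun t => pol (γ t), hc⟩, ?_, ?_⟩, fun t => pol_unitary (hγ t)⟩
  · simp [pol_of_unitary hx]
  · simp [pol_of_unitary (R := R) (x := 1) (by simp)]

/-- similar projections are unitarily equivalent -/
lemma unitary_of_similar {R : Type*} [CStarAlgebra R] {p q w : R} (hp : star p = p)
    (hq : star q = q) (hw : IsUnit w) (h : w * p = q * w) :
    ∃ z : R, star z * z = 1 ∧ z * star z = 1 ∧ z * p = q * z := by
  refine ⟨pol w, (pol_unitary hw).1, (pol_unitary hw).2, ?_⟩
  have h' : p * star w = star w * q := by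
    have := congrArg star h
    simpa [hp, hq] using this
  have hc : Commute (star w * w) p := by
    show star w * w * p = p * (star w * w)
    rw [mul_assoc, h, ← mul_assoc, ← h', mul_assoc]
  have := (invAbs_comm w hc).eq
  unfold pol
  rw [mul_assoc, this, ← mul_assoc, h, mul_assoc]

/-- an almost-projection is near a projection -/
lemma exists_proj {R : Type*} [CStarAlgebra R] {x : R} (hx : star x = x) {ε : ℝ}
    (h4 : ε < 1 / 4) (h : ‖x * x - x‖ ≤ ε) :
    ∃ p : R, star p = p ∧ p * p = p ∧ ‖p - x‖ ≤ 2 * ε := by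
  have hε : 0 ≤ ε := (norm_nonneg _).trans h
  have hsa : IsSelfAdjoint x := hx
  have hspec : ∀ t ∈ spectrum ℝ x, |t * t - t| ≤ ε := by
    intro t ht
    have e1 : x * x - x = cfc (fun t : ℝ => t * t - t) x := by
      rw [cfc_sub (fun t : ℝ => t * t) (fun t => t) x (by fun_prop) (by fun_prop),
        cfc_mul (fun t : ℝ => t) (fun t => t) x (by fun_prop) (by fun_prop), cfc_id' ℝ x]
    have := norm_apply_le_norm_cfc (fun t : ℝ => t * t - t) x ht (by fun_prop)
    rw [← e1] at this
    exact this.trans h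
  let f : ℝ → ℝ := fun t => if t < 1 / 2 then 0 else 1
  have hne : ∀ t ∈ spectrum ℝ x, t ≠ 1 / 2 := by
    rintro t ht rfl
    have := hspec _ ht
    norm_num at this
    linarith
  have hf : ContinuousOn f (spectrum ℝ x) := by
    intro t ht
    apply ContinuousAt.continuousWithinAt
    rcases lt_or_gt_of_ne (hne t ht) with h1 | h1
    · have : f =ᶠ[nhds t] fun _ => 0 := by
        filter_upwards [Iio_mem_nhds h1] with s hs
        simp only [f, if_pos (show s < 1/2 from hs)]
      exact continuousAt_const.congr this.symm
    · have : f =ᶠ[nhds t] fun _ => 1 := by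
        filter_upwards [Ioi_mem_nhds h1] with s hs
        simp only [f, if_neg (not_lt.2 (le_of_lt (show 1/2 < s from hs)))]
      exact continuousAt_const.congr this.symm
  refine ⟨cfc f x, (cfc_predicate f x : IsSelfAdjoint _), ?_, ?_⟩
  · rw [← cfc_mul f f x hf hf]
    apply cfc_congr
    intro t _
    simp only [f]; split_ifs <;> simp
  · have e1 : cfc f x - x = cfc (fun t => f t - t) x := by
      rw [cfc_sub f (fun t => t) x hf (by fun_prop), cfc_id' ℝ x]
    rw [e1]
    apply norm_cfc_le (by linarith)
    intro t ht
    have h1 := abs_le.1 (hspec t ht)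
    simp only [f, Real.norm_eq_abs]
    rw [abs_le]
    split_ifs with h2
    · constructor <;> nlinarith
    · constructor <;> nlinarith

/-- close idempotents have the same trace -/
lemma trace_eq_of_close {R : Type*} [NormedRing R] [CompleteSpace R] [NormedAlgebra ℂ R]
    (T : R →ₗ[ℂ] ℂ) (hT : ∀ x y, T (x * y) = T (y * x)) {p q : R} (hp : p * p = p)
    (hq : q * q = q) (hp1 : ‖p‖ ≤ 1) (hq1 : ‖q‖ ≤ 1) (h : ‖p - q‖ < 1 / 2) : T p = T q := by
  set z := p * q + (1 - p) * (1 - q) with hz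
  have e : 1 - z = -(p * (q - p) + (p - q) * q) := by
    rw [hz]; simp only [mul_sub, sub_mul, hp, hq]; noncomm_ring
  have hn : ‖1 - z‖ < 1 := by
    rw [e, norm_neg]
    calc _ ≤ ‖p‖ * ‖q - p‖ + ‖p - q‖ * ‖q‖ :=
          (norm_add_le _ _).trans (add_le_add (norm_mul_le _ _) (norm_mul_le _ _))
      _ ≤ 1 * ‖p - q‖ + ‖p - q‖ * 1 := by
          rw [norm_sub_rev q p]; gcongr
      _ < 1 := by linarith
  have hu : IsUnit z := by
    have := isUnit_one_sub_of_norm_lt_one hn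
    simpa using this
  obtain ⟨v, hv⟩ := hu
  have h1 : p * z = p * q := by
    rw [hz]; simp only [mul_add, mul_sub, sub_mul, ← mul_assoc, hp]; simp
  have h2 : z * q = p * q := by
    rw [hz]; simp only [add_mul, mul_sub, sub_mul, mul_assoc, hq]; simp
  have h3 : p = v * q * ((v⁻¹ : Rˣ) : R) := by
    rw [hv, h2, ← h1, ← hv, mul_assoc]; simp
  rw [h3, hT, ← mul_assoc]; simp

end K1

namespace K1

lemma similar_end {V : Type*} [AddCommGroup V] [Module ℂ V] [FiniteDimensional ℂ V]
    {p q : Module.End ℂ V} (hp : IsIdempotentElem p) (hq : IsIdempotentElem q)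
    (h : LinearMap.trace ℂ V p = LinearMap.trace ℂ V q) :
    ∃ w : V ≃ₗ[ℂ] V, ∀ x, w (p x) = q (w x) := by
  have cp : IsCompl (LinearMap.range p) (LinearMap.ker p) :=
    LinearMap.IsIdempotentElem.isCompl hp
  have cq : IsCompl (LinearMap.range q) (LinearMap.ker q) :=
    LinearMap.IsIdempotentElem.isCompl hq
  have tp := ((LinearMap.isProj_range_iff_isIdempotentElem p).2 hp).trace
  have tq := ((LinearMap.isProj_range_iff_isIdempotentElem q).2 hq).trace
  have hr : Module.finrank ℂ (LinearMap.range p) = Module.finrank ℂ (LinearMap.range q) := by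
    have := tp.symm.trans (h.trans tq)
    exact_mod_cast this
  have hk : Module.finrank ℂ (LinearMap.ker p) = Module.finrank ℂ (LinearMap.ker q) := by
    have h1 := LinearMap.finrank_range_add_finrank_ker p
    have h2 := LinearMap.finrank_range_add_finrank_ker q
    omega
  let e1 := LinearEquiv.ofFinrankEq _ _ hr
  let e2 := LinearEquiv.ofFinrankEq _ _ hk
  let P := Submodule.prodEquivOfIsCompl _ _ cp
  let Q := Submodule.prodEquivOfIsCompl _ _ cq
  refine ⟨P.symm.trans ((e1.prodCongr e2).trans Q), ?_⟩
  intro x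
  obtain ⟨⟨a, b⟩, rfl⟩ := P.surjective x
  have hPa : ∀ (a : LinearMap.range p) (b : LinearMap.ker p), P (a, b) = (a : V) + b :=
    fun a b => by simp [P]
  have hQa : ∀ (a : LinearMap.range q) (b : LinearMap.ker q), Q (a, b) = (a : V) + b :=
    fun a b => by simp [Q]
  have fixp : ∀ a : LinearMap.range p, p a = a := by
    rintro ⟨_, y, rfl⟩
    exact LinearMap.congr_fun hp y
  have fixq : ∀ a : LinearMap.range q, q a = a := by
    rintro ⟨_, y, rfl⟩
    exact LinearMap.congr_fun hq y
  have h1 : p (P (a, b)) = P (a, 0) := by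
    rw [hPa, hPa, map_add, fixp]
    simp
  have h2 : ∀ a b, q (Q (a, b)) = Q (a, 0) := by
    intro a b
    rw [hQa, hQa, map_add, fixq]
    simp
  rw [h1]
  simp only [LinearEquiv.trans_apply, LinearEquiv.symm_apply_apply, LinearEquiv.prodCongr_apply,
    h2, map_zero]

lemma similar_matrix {d : ℕ} {p q : Matrix (Fin d) (Fin d) ℂ} (hp : p * p = p) (hq : q * q = q)
    (h : p.trace = q.trace) : ∃ w w' : Matrix (Fin d) (Fin d) ℂ,
      w * w' = 1 ∧ w' * w = 1 ∧ w * p = q * w := by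
  have hp' : IsIdempotentElem (Matrix.toLin' p) := by
    show Matrix.toLin' p ∘ₗ Matrix.toLin' p = _
    rw [← Matrix.toLin'_mul, hp]
  have hq' : IsIdempotentElem (Matrix.toLin' q) := by
    show Matrix.toLin' q ∘ₗ Matrix.toLin' q = _
    rw [← Matrix.toLin'_mul, hq]
  obtain ⟨w, hw⟩ := similar_end hp' hq' (by simpa using h)
  refine ⟨LinearMap.toMatrix' w, LinearMap.toMatrix' w.symm, ?_, ?_, ?_⟩
  · rw [← LinearMap.toMatrix'_comp]; simp
  · rw [← LinearMap.toMatrix'_comp]; simp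
  · have : (w : (Fin d → ℂ) →ₗ[ℂ] _) ∘ₗ Matrix.toLin' p = Matrix.toLin' q ∘ₗ w :=
      LinearMap.ext hw
    have := congrArg LinearMap.toMatrix' this
    simpa [LinearMap.toMatrix'_comp] using this

lemma semisimple_of_cstar (R : Type*) [CStarAlgebra R] [FiniteDimensional ℂ R] :
    IsSemisimpleRing R := by
  have : IsArtinianRing R := IsArtinianRing.of_finite ℂ R
  rw [IsArtinianRing.isSemisimpleRing_iff_jacobson, eq_bot_iff]
  intro x hx
  obtain ⟨n, hn⟩ := IsSemiprimaryRing.isNilpotent (R := R)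
  have h1 : star x * x ∈ Ring.jacobson R := Ideal.mul_mem_left _ _ hx
  have h2 : ∀ k, (star x * x) ^ k ∈ (Ring.jacobson R) ^ k := fun k => Ideal.pow_mem_pow h1 k
  have h3 : (star x * x) ^ n = 0 := by
    have := h2 n
    rw [hn] at this
    simpa using this
  have h4 : (star x * x) ^ (2 ^ n) = 0 :=
    pow_eq_zero_of_le (Nat.lt_two_pow_self).le h3
  have hsa : IsSelfAdjoint (star x * x) := .star_mul_self x
  have h5 := hsa.nnnorm_pow_two_pow n
  rw [h4, nnnorm_zero] at h5
  have h6 : star x * x = 0 := by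
    have := (pow_eq_zero_iff (by positivity)).1 h5.symm
    simpa using this
  simpa using h6

lemma similar_fd {R : Type*} [Ring R] [Algebra ℂ R] [FiniteDimensional ℂ R] [IsSemisimpleRing R]
    {p q : R} (hp : p * p = p) (hq : q * q = q)
    (h : ∀ T : R →ₗ[ℂ] ℂ, (∀ x y, T (x * y) = T (y * x)) → T p = T q) :
    ∃ w : R, IsUnit w ∧ w * p = q * w := by
  obtain ⟨n, d, hd, ⟨e⟩⟩ := IsSemisimpleRing.exists_algEquiv_pi_matrix_of_isAlgClosed ℂ R
  have key : ∀ i, ∃ w w' : Matrix (Fin (d i)) (Fin (d i)) ℂ,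
      w * w' = 1 ∧ w' * w = 1 ∧ w * e p i = e q i * w := by
    intro i
    apply similar_matrix
    · rw [← Pi.mul_apply, ← map_mul, hp]
    · rw [← Pi.mul_apply, ← map_mul, hq]
    · refine h ((Matrix.traceLinearMap (Fin (d i)) ℂ ℂ) ∘ₗ (LinearMap.proj i) ∘ₗ
        e.toLinearEquiv.toLinearMap) ?_
      intro x y
      simp [Matrix.trace_mul_comm (e x i)]
  choose w w' h1 h2 h3 using key
  refine ⟨e.symm w, ⟨⟨e.symm w, e.symm w', ?_, ?_⟩, rfl⟩, ?_⟩
  · rw [← map_mul, show w * w' = 1 from funext h1, map_one]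
  · rw [← map_mul, show w' * w = 1 from funext h2, map_one]
  · apply e.injective
    simp only [map_mul, AlgEquiv.apply_symm_apply]
    exact funext h3

end K1

namespace K1
section mat

variable {s : Type*} [Fintype s] {B : Type*} [CStarAlgebra B]
  [PartialOrder B] [StarOrderedRing B]

lemma norm_entry_le (M : CStarMatrix s s B) (i j : s) :
    ‖M i j‖ ≤ ‖M‖ := by
  exact CStarMatrix.norm_entry_le_norm

open WithCStarModule in
lemma norm_le_sum (M : CStarMatrix s s B) :
    ‖M‖ ≤ ∑ j, ∑ i, ‖M i j‖ := by
  show ‖CStarMatrix.toCLM M‖ ≤ _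
  refine (CStarMatrix.toCLM M).opNorm_le_bound (by positivity) fun v => ?_
  simp only [CStarMatrix.toCLM_apply_eq_sum, Finset.sum_mul]
  apply pi_norm_le_sum_norm _ |>.trans
  gcongr with i _
  apply norm_sum_le _ _ |>.trans
  gcongr with j _
  apply norm_mul_le _ _ |>.trans
  rw [mul_comm]
  gcongr
  exact norm_apply_le_norm v j

lemma norm_le_card (M : CStarMatrix s s B) {c : ℝ} (h : ∀ i j, ‖M i j‖ ≤ c) :
    ‖M‖ ≤ (Fintype.card s : ℝ) ^ 2 * c := by
  refine (norm_le_sum M).trans ?_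
  refine (Finset.sum_le_sum fun j _ => Finset.sum_le_sum fun i _ => h i j).trans ?_
  simp
  apply le_of_eq; ring

variable [DecidableEq s]

/-- the comparison lemma for matrices over a finite-dimensional C*-algebra -/
lemma compare_aux [FiniteDimensional ℂ B] {p q : Matrix s s B} (hp : p * p = p) (hq : q * q = q)
    (hp' : star p = p) (hq' : star q = q)
    (h : ∀ τ : B →ₗ[ℂ] ℂ, (∀ x y, τ (x * y) = τ (y * x)) → τ p.trace = τ q.trace) :
    ∃ z : Matrix s s B, star z * z = 1 ∧ z * star z = 1 ∧ z * p = q * z ∧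
      ∀ a b, ‖z a b‖ ≤ 1 := by
  have : FiniteDimensional ℂ (CStarMatrix s s B) :=
    inferInstanceAs (FiniteDimensional ℂ (Matrix s s B))
  have := semisimple_of_cstar (CStarMatrix s s B)
  suffices H : ∃ w : CStarMatrix s s B, IsUnit w ∧ w * (show CStarMatrix s s B from p) = (show CStarMatrix s s B from q) * w by
    obtain ⟨w, hw, h1⟩ := H
    obtain ⟨z, h1, h2, h3⟩ := unitary_of_similar (R := CStarMatrix s s B) (p := p) (q := q) hp' hq' hw h1
    refine ⟨z, h1, h2, h3, fun a b => (norm_entry_le z a b).trans ?_⟩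
    have : ‖z‖ * ‖z‖ ≤ 1 := by
      rw [← CStarRing.norm_star_mul_self, h1]
      rcases subsingleton_or_nontrivial (CStarMatrix s s B) with h | h
      · rw [Subsingleton.elim (1 : CStarMatrix s s B) 0, norm_zero]; exact zero_le_one
      · rw [CStarRing.norm_one]
    nlinarith [norm_nonneg z]
  refine similar_fd (R := CStarMatrix s s B) (p := p) (q := q) hp hq ?_
  intro T hT
  rcases isEmpty_or_nonempty s with hs | ⟨⟨o⟩⟩
  · congr 1; ext i; exact hs.elim i
  let S : s → s → B →ₗ[ℂ] CStarMatrix s s B := fun a b => Matrix.singleLinearMap ℂ a b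
  have hmul : ∀ a b c x y, S a b x * S b c y = S a c (x * y) := fun a b c x y =>
    Matrix.single_mul_single_same (α := B) (c := x) (i := a) (j := b) (k := c) (d := y)
  have hmul0 : ∀ a b b' c x y, b ≠ b' → S a b x * S b' c y = 0 := fun a b b' c x y hb =>
    Matrix.single_mul_single_of_ne (α := B) (h := hb) ..
  let τ : B →ₗ[ℂ] ℂ := T ∘ₗ S o o
  have hτ : ∀ x y, τ (x * y) = τ (y * x) := by
    intro x y
    show T (S o o (x * y)) = T (S o o (y * x))
    rw [← hmul o o o, hT, hmul]
  have hS : ∀ a b x, T (S a b x) = if a = b then τ x else 0 := by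
    intro a b x
    have : S a b x = S a o x * S o b 1 := by rw [hmul, mul_one]
    rw [this, hT]
    split_ifs with hab
    · subst hab
      rw [hmul, one_mul]; rfl
    · rw [hmul0 _ _ _ _ _ _ (Ne.symm hab), map_zero]
  have hdec : ∀ x : CStarMatrix s s B, T x = τ (Matrix.trace x) := by
    intro x
    have : x = ∑ a, ∑ b, S a b (x a b) := Matrix.matrix_eq_sum_single (α := B) x
    conv_lhs => rw [this]
    simp only [map_sum, hS, Finset.sum_ite_eq, Finset.mem_univ, if_true, Matrix.trace,
      Matrix.diag]
  exact (hdec p).trans ((h τ hτ).trans (hdec q).symm)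

lemma exists_proj_mat_aux {x : Matrix s s B} (hx : star x = x) {δ : ℝ} 
    (hδ : (Fintype.card s : ℝ) ^ 2 * δ < 1 / 4) (h : ∀ a b, ‖(x * x - x) a b‖ ≤ δ) :
    ∃ p : Matrix s s B, star p = p ∧ p * p = p ∧
      ∀ a b, ‖(p - x) a b‖ ≤ 2 * ((Fintype.card s : ℝ) ^ 2 * δ) := by
  obtain ⟨p, h1, h2, h3⟩ := exists_proj (R := CStarMatrix s s B) (x := x) hx hδ
    (norm_le_card _ h)
  exact ⟨p, h1, h2, fun a b => (norm_entry_le (B := B) _ a b).trans h3⟩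

lemma trace_close_mat_aux {p q : Matrix s s B} (hp : p * p = p) (hq : q * q = q)
    (hp' : star p = p) (hq' : star q = q) {δ : ℝ} (hδ : (Fintype.card s : ℝ) ^ 2 * δ < 1 / 2)
    (h : ∀ a b, ‖(p - q) a b‖ ≤ δ)
    (τ : B →ₗ[ℂ] ℂ) (hτ : ∀ x y, τ (x * y) = τ (y * x)) : τ p.trace = τ q.trace := by
  have nle : ∀ p : CStarMatrix s s B, p * p = p → star p = p → ‖p‖ ≤ 1 := by
    intro p h1 h2
    have h3 := CStarRing.norm_star_mul_self (x := p)
    rw [h2, h1] at h3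
    by_contra hh
    nlinarith
  let T : CStarMatrix s s B →ₗ[ℂ] ℂ := τ ∘ₗ Matrix.traceLinearMap s ℂ B
  have hT : ∀ x y, T (x * y) = T (y * x) := by
    intro x y
    show τ (Matrix.trace (R := B) _ ) = τ (Matrix.trace (R := B) _)
    simp only [Matrix.trace, Matrix.diag, map_sum]
    simp only [CStarMatrix.mul_apply, map_sum]
    rw [Finset.sum_comm]
    simp only [hτ]
  exact trace_eq_of_close (R := CStarMatrix s s B) T hT (p := p) (q := q) hp hq (nle p hp hp') (nle q hq hq')
    ((norm_le_card _ h).trans_lt hδ)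

end mat

section wrap
variable {s : Type*} [Fintype s] [DecidableEq s] {B : Type*} [CStarAlgebra B]

lemma compare [FiniteDimensional ℂ B] {p q : Matrix s s B} (hp : p * p = p) (hq : q * q = q)
    (hp' : star p = p) (hq' : star q = q)
    (h : ∀ τ : B →ₗ[ℂ] ℂ, (∀ x y, τ (x * y) = τ (y * x)) → τ p.trace = τ q.trace) :
    ∃ z : Matrix s s B, star z * z = 1 ∧ z * star z = 1 ∧ z * p = q * z ∧
      ∀ a b, ‖z a b‖ ≤ 1 := by
  let _ := CStarAlgebra.spectralOrder B
  let _ := CStarAlgebra.spectralOrderedRing B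
  exact compare_aux hp hq hp' hq' h

lemma exists_proj_mat {x : Matrix s s B} (hx : star x = x) {δ : ℝ}
    (hδ : (Fintype.card s : ℝ) ^ 2 * δ < 1 / 4) (h : ∀ a b, ‖(x * x - x) a b‖ ≤ δ) :
    ∃ p : Matrix s s B, star p = p ∧ p * p = p ∧
      ∀ a b, ‖(p - x) a b‖ ≤ 2 * ((Fintype.card s : ℝ) ^ 2 * δ) := by
  let _ := CStarAlgebra.spectralOrder B
  let _ := CStarAlgebra.spectralOrderedRing B
  exact exists_proj_mat_aux hx hδ h

lemma trace_close_mat {p q : Matrix s s B} (hp : p * p = p) (hq : q * q = q)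
    (hp' : star p = p) (hq' : star q = q) {δ : ℝ} (hδ : (Fintype.card s : ℝ) ^ 2 * δ < 1 / 2)
    (h : ∀ a b, ‖(p - q) a b‖ ≤ δ)
    (τ : B →ₗ[ℂ] ℂ) (hτ : ∀ x y, τ (x * y) = τ (y * x)) : τ p.trace = τ q.trace := by
  let _ := CStarAlgebra.spectralOrder B
  let _ := CStarAlgebra.spectralOrderedRing B
  exact trace_close_mat_aux hp hq hp' hq' hδ h τ hτ

/-- joining by invertibles suffices, at matrix level -/
lemma joined_unitary_mat {x : Matrix s s B} (hx : star x * x = 1)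
    (h : JoinedIn {y : Matrix s s B | IsUnit y} x 1) :
    JoinedIn {y : Matrix s s B | star y * y = 1 ∧ y * star y = 1} x 1 := by
  let _ := CStarAlgebra.spectralOrder B
  let _ := CStarAlgebra.spectralOrderedRing B
  exact joined_unitary (R := CStarMatrix s s B) (x := x) hx h

lemma isUnit_mat_of_close {x : Matrix s s B} {δ : ℝ} (hδ : (Fintype.card s : ℝ) ^ 2 * δ < 1)
    (h : ∀ a b, ‖(1 - x) a b‖ ≤ δ) : IsUnit x := by
  let _ := CStarAlgebra.spectralOrder B
  let _ := CStarAlgebra.spectralOrderedRing B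
  have := isUnit_one_sub_of_norm_lt_one (R := CStarMatrix s s B) (x := 1 - (show CStarMatrix s s B from x))
    ((norm_le_card _ h).trans_lt hδ)
  have := (sub_sub_cancel (1 : CStarMatrix s s B) x) ▸ this
  exact this

end wrap

end K1

namespace K1
variable {A : Type u} [CStarAlgebra A]

/-- `S + ℂ 1` -/
def til (S : NonUnitalStarSubalgebra ℂ A) : StarSubalgebra ℂ A where
  carrier := {x | ∃ s ∈ S, ∃ c : ℂ, x = s + algebraMap ℂ A c}
  mul_mem' := by
    rintro _ _ ⟨s, hs, c, rfl⟩ ⟨t, ht, d, rfl⟩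
    refine ⟨s * t + d • s + c • t, ?_, c * d, ?_⟩
    · exact add_mem (add_mem (mul_mem hs ht) (SMulMemClass.smul_mem _ hs)) (SMulMemClass.smul_mem _ ht)
    · simp only [Algebra.algebraMap_eq_smul_one, mul_add, add_mul, mul_smul_comm, smul_mul_assoc,
        mul_one, one_mul]
      module
  add_mem' := by
    rintro _ _ ⟨s, hs, c, rfl⟩ ⟨t, ht, d, rfl⟩
    refine ⟨s + t, add_mem hs ht, c + d, ?_⟩
    rw [map_add]; abel
  algebraMap_mem' := fun c => ⟨0, zero_mem _, c, by simp⟩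
  star_mem' := by
    rintro _ ⟨s, hs, c, rfl⟩
    refine ⟨star s, star_mem hs, star c, ?_⟩
    rw [star_add, algebraMap_star_comm]

lemma mem_til {S : NonUnitalStarSubalgebra ℂ A} {x : A} :
    x ∈ til S ↔ ∃ s ∈ S, ∃ c : ℂ, x = s + algebraMap ℂ A c := Iff.rfl

lemma til_mono {S T : NonUnitalStarSubalgebra ℂ A} (h : S ≤ T) : til S ≤ til T := by
  rintro _ ⟨s, hs, c, rfl⟩
  exact ⟨s, h hs, c, rfl⟩

lemma le_til {S : NonUnitalStarSubalgebra ℂ A} {x : A} (h : x ∈ S) : x ∈ til S :=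
  ⟨x, h, 0, by simp⟩

lemma til_fd (G : NonUnitalStarSubalgebra ℂ A) [FiniteDimensional ℂ G] :
    FiniteDimensional ℂ (til G) := by
  let f : (G × ℂ) →ₗ[ℂ] til G :=
    { toFun := fun x => ⟨(x.1 : A) + algebraMap ℂ A x.2, x.1, x.1.2, x.2, rfl⟩
      map_add' := by
        intro x y
        ext
        simp only [Prod.fst_add, Prod.snd_add, map_add]
        push_cast
        abel
      map_smul' := by
        intro c x
        ext
        simp [Algebra.algebraMap_eq_smul_one, smul_smul] }
  refine Module.Finite.of_surjective f ?_
  rintro ⟨_, s, hs, c, rfl⟩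
  exact ⟨(⟨s, hs⟩, c), rfl⟩

lemma til_closed (G : NonUnitalStarSubalgebra ℂ A) [FiniteDimensional ℂ G] :
    IsClosed (til G : Set A) := by
  have := til_fd G
  have h : FiniteDimensional ℂ (Subalgebra.toSubmodule (til G).toSubalgebra) := this
  exact Submodule.closed_of_finiteDimensional (Subalgebra.toSubmodule (til G).toSubalgebra)

lemma joined_of_isIntegral {R : Type*} [Ring R] [Algebra ℂ R] [TopologicalSpace R]
    [IsTopologicalRing R] [ContinuousSMul ℂ R] {y : R} (hy : IsUnit y) (h : IsIntegral ℂ y) :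
    JoinedIn {x : R | IsUnit x} y 1 := by
  obtain ⟨p, hp, hp0⟩ := h
  have hp0 : Polynomial.aeval y p = 0 := hp0
  rcases subsingleton_or_nontrivial R with hs | hs
  · rw [Subsingleton.elim y 1]
    exact JoinedIn.refl isUnit_one
  have hfin : (spectrum ℂ y).Finite := by
    refine (p.rootSet_finite ℂ).subset ?_
    intro t ht
    rw [Polynomial.mem_rootSet]
    refine ⟨hp.ne_zero, ?_⟩
    have := spectrum.subset_polynomial_aeval y p ⟨t, ht, rfl⟩
    rw [hp0, spectrum.zero_eq] at this
    simpa using this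
  let bad : Set ℂ := (fun t => (1 - t)⁻¹) '' spectrum ℂ y
  have hbad : bad.Finite := hfin.image _
  have hgood : ∀ l : ℂ, l ≠ 0 → l ∉ bad → IsUnit (1 + l • (y - 1)) := by
    intro l hl0 hl
    have h1 : (1 - l⁻¹) ∉ spectrum ℂ y := by
      intro h
      exact hl ⟨_, h, by simp⟩
    rw [spectrum.notMem_iff] at h1
    have e : 1 + l • (y - 1) = algebraMap ℂ R (-l) * (algebraMap ℂ R (1 - l⁻¹) - y) := by
      rw [mul_sub, ← map_mul, ← Algebra.smul_def, Algebra.algebraMap_eq_smul_one, mul_sub,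
        neg_mul l l⁻¹, mul_inv_cancel₀ hl0, smul_sub]
      module
    rw [e]
    exact ((IsUnit.mk0 _ (neg_ne_zero.2 hl0)).map (algebraMap ℂ R)).mul h1
  let bad' : Set ℂ := bad \ {0, 1}
  have hcount : bad'.Countable := (hbad.subset Set.sdiff_subset).countable
  have hgood' : ∀ l ∈ bad'ᶜ, IsUnit (1 + l • (y - 1)) := by
    intro l hl
    by_cases h0 : l = 0
    · simp [h0]
    by_cases h1 : l = 1
    · simpa [h1] using hy
    · exact hgood l h0 fun h => hl ⟨h, by simp [h0, h1]⟩
  have hpc := hcount.isPathConnected_compl_of_one_lt_rank (E := ℂ)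
    (by rw [Complex.rank_real_complex]; norm_num)
  obtain ⟨γ, hγ⟩ := hpc.joinedIn 1 (by simp [bad']) 0 (by simp [bad'])
  refine ⟨⟨⟨fun t => 1 + γ t • (y - 1), by fun_prop⟩, by simp, by simp⟩, fun t => hgood' _ (hγ t)⟩

section
variable {s : Type*} [Fintype s] [DecidableEq s]

lemma joined_of_close {R : Type*} [NormedRing R] [NormedAlgebra ℂ R] [CompleteSpace R]
    {y : R} (hy : IsUnit y) :
    ∃ e > 0, ∀ y' : R, ‖y' - y‖ < e → JoinedIn {x : R | IsUnit x} y y' := by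
  have ho : IsOpen {x : R | IsUnit x} := Units.isOpen
  obtain ⟨e, he, hball⟩ := Metric.isOpen_iff.1 ho y hy
  refine ⟨e, he, fun y' h => ?_⟩
  let _ : NormedSpace ℝ R := NormedSpace.restrictScalars ℝ ℂ R
  have := (convex_ball y e).isPathConnected ⟨y, Metric.mem_ball_self he⟩
  exact (this.joinedIn y (Metric.mem_ball_self he) y' (by rwa [mem_ball_iff_norm])).mono hball

lemma joined_of_close_mat {y : Matrix s s A} (hy : IsUnit y) :
    ∃ δ > 0, ∀ y' : Matrix s s A, (∀ a b, ‖(y' - y) a b‖ ≤ δ) →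
      JoinedIn {x : Matrix s s A | IsUnit x} y y' := by
  let _ := CStarAlgebra.spectralOrder A
  let _ := CStarAlgebra.spectralOrderedRing A
  obtain ⟨e, he, H⟩ := joined_of_close (R := CStarMatrix s s A) (y := y) hy
  refine ⟨e / 2 / ((Fintype.card s : ℝ) ^ 2 + 1), by positivity, fun y' h => ?_⟩
  have h2 : (Fintype.card s : ℝ) ^ 2 * (e / 2 / ((Fintype.card s : ℝ) ^ 2 + 1)) < e := by
    rw [mul_div_assoc', div_lt_iff₀ (by positivity)]
    nlinarith [sq_nonneg (Fintype.card s : ℝ)]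
  exact H y' ((norm_le_card (B := A) _ h).trans_lt h2)

lemma isIntegral_mat {G : NonUnitalStarSubalgebra ℂ A} [FiniteDimensional ℂ G]
    {y : Matrix s s A} (h : ∀ a b, y a b ∈ til G) : IsIntegral ℂ y := by
  have := til_fd G
  let y₀ : Matrix s s (til G) := fun a b => ⟨y a b, h a b⟩
  have h0 : IsIntegral ℂ y₀ := IsIntegral.of_finite ℂ y₀
  have := h0.map ((til G).subtype.toAlgHom.mapMatrix (m := s))
  exact this

lemma joined_til {S : NonUnitalStarSubalgebra ℂ A}
    (hS : ∀ (Y : Finset A), (↑Y : Set A) ⊆ (S : Set A) → ∀ δ : ℝ, 0 < δ →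
    ∃ G : NonUnitalStarSubalgebra ℂ A, G ≤ S ∧ FiniteDimensional ℂ G ∧
      ∀ y ∈ Y, ∃ s ∈ G, ‖y - s‖ < δ)
    {y : Matrix s s A} (hy : IsUnit y) (h : ∀ a b, y a b ∈ til S) :
    JoinedIn {x : Matrix s s A | IsUnit x} y 1 := by
  classical
  obtain ⟨δ, hδ, H⟩ := joined_of_close_mat hy
  choose t ht c hc using h
  obtain ⟨G, -, hG, hY⟩ := hS (Finset.univ.image fun ab : s × s => t ab.1 ab.2)
    (by
      intro x hx
      simp only [Finset.coe_image, Set.mem_image] at hx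
      obtain ⟨ab, -, rfl⟩ := hx
      exact ht _ _) δ hδ
  have hY' : ∀ a b, ∃ g ∈ G, ‖t a b - g‖ < δ := fun a b =>
    hY _ (Finset.mem_image.2 ⟨(a, b), Finset.mem_univ _, rfl⟩)
  choose g hg hgt using hY'
  let y' : Matrix s s A := fun a b => g a b + algebraMap ℂ A (c a b)
  have hj := H y' (by
    intro a b
    have : (y' - y) a b = g a b - t a b := by
      show g a b + algebraMap ℂ A (c a b) - y a b = _
      rw [hc]; abel
    rw [this, norm_sub_rev]
    exact (hgt a b).le)
  exact hj.trans (joined_of_isIntegral hj.target_mem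
    (isIntegral_mat (G := G) fun a b => ⟨g a b, hg a b, c a b, rfl⟩))

end
end K1

namespace K1
open Filter Topology

section seq
variable (A : Type u) [CStarAlgebra A]

/-- bounded sequences -/
def bdd : Subring (ℕ → A) where
  carrier := {x | ∃ c : ℝ, ∀ j, ‖x j‖ ≤ c}
  mul_mem' := by
    rintro x y ⟨c, hc⟩ ⟨d, hd⟩
    exact ⟨c * d, fun j => (norm_mul_le _ _).trans
      (mul_le_mul (hc j) (hd j) (norm_nonneg _) ((norm_nonneg _).trans (hc j)))⟩
  one_mem' := ⟨‖(1 : A)‖, fun _ => le_rfl⟩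
  add_mem' := by
    rintro x y ⟨c, hc⟩ ⟨d, hd⟩
    exact ⟨c + d, fun j => (norm_add_le _ _).trans (add_le_add (hc j) (hd j))⟩
  zero_mem' := ⟨0, fun _ => by simp⟩
  neg_mem' := by
    rintro x ⟨c, hc⟩
    exact ⟨c, fun j => by simpa using hc j⟩

/-- null sequences -/
def nul : Ideal (bdd A) where
  carrier := {x | Tendsto (fun j => ‖(x : ℕ → A) j‖) atTop (𝓝 0)}
  add_mem' := by
    intro x y hx hy
    have := Filter.Tendsto.add hx hy
    rw [add_zero] at this
    exact squeeze_zero (fun _ => norm_nonneg _) (fun j => norm_add_le _ _) this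
  zero_mem' := by simp
  smul_mem' := by
    rintro ⟨x, c, hc⟩ y hy
    have := Filter.Tendsto.const_mul c hy
    rw [mul_zero] at this
    exact squeeze_zero (fun _ => norm_nonneg _) (fun j => (norm_mul_le _ _).trans
      (mul_le_mul_of_nonneg_right (hc j) (norm_nonneg _))) this

instance : (nul A).IsTwoSided where
  mul_mem_of_left := by
    rintro x ⟨y, c, hc⟩ hx
    have := Filter.Tendsto.mul_const c hx
    rw [zero_mul] at this
    exact squeeze_zero (fun _ => norm_nonneg _) (fun j => (norm_mul_le _ _).trans
      (mul_le_mul_of_nonneg_left (hc j) (norm_nonneg _))) this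

/-- the sequence algebra -/
def SQ : Type u := bdd A ⧸ nul A

noncomputable instance : Ring (SQ A) := inferInstanceAs (Ring (bdd A ⧸ nul A))

/-- the quotient map -/
noncomputable def qmk : bdd A →+* SQ A := Ideal.Quotient.mk (nul A)

variable {A}

lemma qmk_eq {x y : bdd A} : qmk A x = qmk A y ↔
    Tendsto (fun j => ‖(x : ℕ → A) j - (y : ℕ → A) j‖) atTop (𝓝 0) :=
  Ideal.Quotient.eq

lemma qmk_surj : Function.Surjective (qmk A) := Ideal.Quotient.mk_surjective

/-- star on bounded sequences -/
def bstar (x : bdd A) : bdd A := ⟨fun j => star ((x : ℕ → A) j), by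
  obtain ⟨x, c, hc⟩ := x
  exact ⟨c, fun j => by simpa using hc j⟩⟩

noncomputable instance : Star (SQ A) :=
  ⟨fun q => qmk A (bstar (Function.surjInv qmk_surj q))⟩

lemma star_qmk (x : bdd A) : star (qmk A x) = qmk A (bstar x) := by
  refine qmk_eq.2 ?_
  have := qmk_eq.1 (Function.surjInv_eq (qmk_surj (A := A)) (qmk A x))
  refine this.congr fun j => ?_
  rw [← norm_star, star_sub]; rfl

noncomputable instance : StarRing (SQ A) where
  star_involutive q := by
    obtain ⟨x, rfl⟩ := qmk_surj q
    rw [star_qmk, star_qmk]; congr 1; ext j; simp [bstar]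
  star_mul q p := by
    obtain ⟨x, rfl⟩ := qmk_surj q
    obtain ⟨y, rfl⟩ := qmk_surj p
    rw [← map_mul, star_qmk, star_qmk, star_qmk, ← map_mul]; congr 1; ext j; simp [bstar]
  star_add q p := by
    obtain ⟨x, rfl⟩ := qmk_surj q
    obtain ⟨y, rfl⟩ := qmk_surj p
    rw [← map_add, star_qmk, star_qmk, star_qmk, ← map_add]; congr 1; ext j; simp [bstar]

/-- `x` represents `q` -/
def Rep (x : ℕ → A) (q : SQ A) : Prop := ∃ h : x ∈ bdd A, qmk A ⟨x, h⟩ = q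

lemma exists_rep (q : SQ A) : ∃ x, Rep x q := by
  obtain ⟨x, rfl⟩ := qmk_surj q
  exact ⟨x, x.2, rfl⟩

lemma Rep.add {x y : ℕ → A} {p q : SQ A} (hx : Rep x p) (hy : Rep y q) :
    Rep (fun j => x j + y j) (p + q) := by
  obtain ⟨h, rfl⟩ := hx; obtain ⟨k, rfl⟩ := hy
  exact ⟨add_mem h k, by rw [← map_add]; rfl⟩

lemma Rep.mul {x y : ℕ → A} {p q : SQ A} (hx : Rep x p) (hy : Rep y q) :
    Rep (fun j => x j * y j) (p * q) := by
  obtain ⟨h, rfl⟩ := hx; obtain ⟨k, rfl⟩ := hy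
  exact ⟨mul_mem h k, by rw [← map_mul]; rfl⟩

lemma Rep.sub {x y : ℕ → A} {p q : SQ A} (hx : Rep x p) (hy : Rep y q) :
    Rep (fun j => x j - y j) (p - q) := by
  obtain ⟨h, rfl⟩ := hx; obtain ⟨k, rfl⟩ := hy
  exact ⟨sub_mem h k, by rw [← map_sub]; rfl⟩

lemma Rep.neg {x : ℕ → A} {p : SQ A} (hx : Rep x p) : Rep (fun j => - x j) (-p) := by
  obtain ⟨h, rfl⟩ := hx
  exact ⟨neg_mem h, by rw [← map_neg]; rfl⟩

lemma Rep.star {x : ℕ → A} {p : SQ A} (hx : Rep x p) : Rep (fun j => star (x j)) (star p) := by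
  obtain ⟨h, rfl⟩ := hx
  exact ⟨(bstar ⟨x, h⟩).2, by rw [star_qmk]; rfl⟩

lemma Rep.one : Rep (fun _ => (1 : A)) 1 := ⟨one_mem _, map_one _⟩
lemma Rep.zero : Rep (fun _ => (0 : A)) 0 := ⟨zero_mem _, map_zero _⟩

lemma Rep.sum {ι : Type*} (s : Finset ι) {x : ι → ℕ → A} {q : ι → SQ A}
    (h : ∀ i ∈ s, Rep (x i) (q i)) : Rep (fun j => ∑ i ∈ s, x i j) (∑ i ∈ s, q i) := by
  classical
  induction s using Finset.induction_on with
  | empty => simpa using Rep.zero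
  | insert a s ha ih =>
    simp only [Finset.sum_insert ha]
    exact (h a (Finset.mem_insert_self _ _)).add
      (ih fun i hi => h i (Finset.mem_insert_of_mem hi))

lemma Rep.tendsto {x y : ℕ → A} {q : SQ A} (hx : Rep x q) (hy : Rep y q) :
    Tendsto (fun j => ‖x j - y j‖) atTop (𝓝 0) := by
  obtain ⟨h, rfl⟩ := hx; obtain ⟨k, hk⟩ := hy
  exact qmk_eq.1 hk.symm

lemma Rep.eq {x y : ℕ → A} {p q : SQ A} (hx : Rep x p) (hy : Rep y q)
    (h : Tendsto (fun j => ‖x j - y j‖) atTop (𝓝 0)) : p = q := by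
  obtain ⟨_, rfl⟩ := hx; obtain ⟨_, rfl⟩ := hy
  exact qmk_eq.2 h

lemma Rep.congr {x y : ℕ → A} {q : SQ A} (hx : Rep x q)
    (h : Tendsto (fun j => ‖y j - x j‖) atTop (𝓝 0)) : Rep y q := by
  obtain ⟨⟨c, hc⟩, rfl⟩ := hx
  have hb : y ∈ bdd A := by
    obtain ⟨d, hd⟩ := h.bddAbove_range
    refine ⟨d + c, fun j => ?_⟩
    have h1 : ‖y j - x j‖ ≤ d := hd ⟨j, rfl⟩
    calc ‖y j‖ = ‖(y j - x j) + x j‖ := by simp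
      _ ≤ _ := (norm_add_le _ _).trans (add_le_add h1 (hc j))
  exact ⟨hb, qmk_eq.2 h⟩

lemma Rep.bound {x : ℕ → A} {q : SQ A} (hx : Rep x q) : ∃ c : ℝ, 0 < c ∧ ∀ j, ‖x j‖ ≤ c := by
  obtain ⟨⟨c, hc⟩, rfl⟩ := hx
  exact ⟨max c 1, by positivity, fun j => (hc j).trans (le_max_left _ _)⟩

lemma tendsto_of_eventuallyEq {x y : ℕ → A} (h : ∀ᶠ j in atTop, x j = y j) :
    Tendsto (fun j => ‖x j - y j‖) atTop (𝓝 0) := by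
  refine tendsto_const_nhds.congr' ?_
  filter_upwards [h] with j hj
  simp [hj]

/-- constant sequences -/
noncomputable def cst : A →+* SQ A where
  toFun a := qmk A ⟨fun _ => a, ‖a‖, fun _ => le_rfl⟩
  map_one' := map_one (qmk A)
  map_zero' := map_zero (qmk A)
  map_add' _ _ := by rw [← map_add]; rfl
  map_mul' _ _ := by rw [← map_mul]; rfl

lemma rep_cst (a : A) : Rep (fun _ => a) (cst a) := ⟨⟨‖a‖, fun _ => le_rfl⟩, rfl⟩

lemma star_cst (a : A) : star (cst a) = cst (star a) :=
  (rep_cst a).star.eq (rep_cst (star a)) (by simp)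

/-- `q` has a representative with `x j ∈ S j` -/
def In {σ : Type*} [SetLike σ A] (S : ℕ → σ) (q : SQ A) : Prop :=
  ∃ x, Rep x q ∧ ∀ j, x j ∈ S j

section
variable {σ : Type*} [SetLike σ A] {S : ℕ → σ}

lemma In.add [AddMemClass σ A] {p q : SQ A} (hp : In S p) (hq : In S q) : In S (p + q) := by
  obtain ⟨x, hx, hx'⟩ := hp; obtain ⟨y, hy, hy'⟩ := hq
  exact ⟨_, hx.add hy, fun j => add_mem (hx' j) (hy' j)⟩

lemma In.mul [MulMemClass σ A] {p q : SQ A} (hp : In S p) (hq : In S q) : In S (p * q) := by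
  obtain ⟨x, hx, hx'⟩ := hp; obtain ⟨y, hy, hy'⟩ := hq
  exact ⟨_, hx.mul hy, fun j => mul_mem (hx' j) (hy' j)⟩

lemma In.star [StarMemClass σ A] {p : SQ A} (hp : In S p) : In S (star p) := by
  obtain ⟨x, hx, hx'⟩ := hp
  exact ⟨_, hx.star, fun j => star_mem (hx' j)⟩

lemma In.neg {S : ℕ → NonUnitalStarSubalgebra ℂ A} {p : SQ A} (hp : In S p) : In S (-p) := by
  obtain ⟨x, hx, hx'⟩ := hp
  exact ⟨_, hx.neg, fun j => neg_mem (hx' j)⟩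

lemma In.sub {S : ℕ → NonUnitalStarSubalgebra ℂ A} {p q : SQ A} (hp : In S p) (hq : In S q) :
    In S (p - q) := by
  rw [sub_eq_add_neg]; exact hp.add hq.neg

lemma In.of_approx {q : SQ A} {x : ℕ → A} (hx : Rep x q) {ε : ℕ → ℝ}
    (hε : Tendsto ε atTop (𝓝 0)) (h : ∀ j, ∃ s ∈ S j, ‖x j - s‖ ≤ ε j) : In S q := by
  choose s hs hs' using h
  refine ⟨s, hx.congr ?_, hs⟩
  exact squeeze_zero (fun _ => norm_nonneg _) (fun j => by rw [norm_sub_rev]; exact hs' j) hε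
end

/-- the subring of classes of bounded sequences in `S j + ℂ` -/
def tl (S : ℕ → NonUnitalStarSubalgebra ℂ A) : Subring (SQ A) where
  carrier := {q | In (fun j => til (S j)) q}
  mul_mem' hp hq := In.mul hp hq
  one_mem' := ⟨_, Rep.one, fun _ => one_mem _⟩
  add_mem' hp hq := In.add hp hq
  zero_mem' := ⟨_, Rep.zero, fun _ => zero_mem _⟩
  neg_mem' := by
    rintro p ⟨x, hx, hx'⟩
    exact ⟨_, hx.neg, fun j => neg_mem (hx' j)⟩

lemma mem_tl {S : ℕ → NonUnitalStarSubalgebra ℂ A} {q : SQ A} :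
    q ∈ tl S ↔ In (fun j => til (S j)) q := Iff.rfl

lemma In.mem_tl {S : ℕ → NonUnitalStarSubalgebra ℂ A} {q : SQ A} (h : In S q) : q ∈ tl S := by
  obtain ⟨x, hx, hx'⟩ := h
  exact ⟨x, hx, fun j => le_til (hx' j)⟩

lemma tl_mono {S T : ℕ → NonUnitalStarSubalgebra ℂ A} (h : ∀ j, S j ≤ T j) : tl S ≤ tl T := by
  rintro q ⟨x, hx, hx'⟩
  exact ⟨x, hx, fun j => til_mono (h j) (hx' j)⟩

/-- asymptotic norm bound -/
def AN (c : ℝ) (q : SQ A) : Prop := ∃ x, Rep x q ∧ ∀ j, ‖x j‖ ≤ c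

lemma AN.add {c d : ℝ} {p q : SQ A} (hp : AN c p) (hq : AN d q) : AN (c + d) (p + q) := by
  obtain ⟨x, hx, hx'⟩ := hp; obtain ⟨y, hy, hy'⟩ := hq
  exact ⟨_, hx.add hy, fun j => (norm_add_le _ _).trans (add_le_add (hx' j) (hy' j))⟩

lemma AN.sub {c d : ℝ} {p q : SQ A} (hp : AN c p) (hq : AN d q) : AN (c + d) (p - q) := by
  obtain ⟨x, hx, hx'⟩ := hp; obtain ⟨y, hy, hy'⟩ := hq
  exact ⟨_, hx.sub hy, fun j => (norm_sub_le _ _).trans (add_le_add (hx' j) (hy' j))⟩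

lemma AN.neg {c : ℝ} {p : SQ A} (hp : AN c p) : AN c (-p) := by
  obtain ⟨x, hx, hx'⟩ := hp
  exact ⟨_, hx.neg, fun j => by rw [norm_neg]; exact hx' j⟩

lemma AN.mul {c d : ℝ} {p q : SQ A} (hp : AN c p) (hq : AN d q) : AN (c * d) (p * q) := by
  obtain ⟨x, hx, hx'⟩ := hp; obtain ⟨y, hy, hy'⟩ := hq
  exact ⟨_, hx.mul hy, fun j => (norm_mul_le _ _).trans
      (mul_le_mul (hx' j) (hy' j) (norm_nonneg _) ((norm_nonneg _).trans (hx' j)))⟩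

lemma AN.mono {c d : ℝ} {p : SQ A} (hp : AN c p) (h : c ≤ d) : AN d p := by
  obtain ⟨x, hx, hx'⟩ := hp
  exact ⟨_, hx, fun j => (hx' j).trans h⟩

lemma AN.cst {a : A} {c : ℝ} (h : ‖a‖ ≤ c) : AN c (cst a) := ⟨_, rep_cst a, fun _ => h⟩

lemma AN.eventually {c d : ℝ} {p : SQ A} (hp : AN c p) (h : c < d) {x : ℕ → A} (hx : Rep x p) :
    ∀ᶠ j in atTop, ‖x j‖ ≤ d := by
  obtain ⟨y, hy, hy'⟩ := hp
  have := (hx.tendsto hy).eventually (ge_mem_nhds (show (0 : ℝ) < d - c by linarith))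
  filter_upwards [this] with j hj
  calc ‖x j‖ = ‖(x j - y j) + y j‖ := by simp
    _ ≤ (d - c) + c := (norm_add_le _ _).trans (add_le_add hj (hy' j))
    _ = d := by ring

end seq
end K1

namespace K1
open Filter Topology

variable {A : Type u} [CStarAlgebra A]

lemma norm_one_le_one : ‖(1 : A)‖ ≤ 1 := by
  rcases subsingleton_or_nontrivial A with h | h
  · rw [Subsingleton.elim (1 : A) 0, norm_zero]; exact zero_le_one
  · rw [CStarRing.norm_one]

lemma contr_facts {h : A} (hp : ∃ x : A, h = star x * x) (hn : ‖h‖ ≤ 1) :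
    star h = h ∧ ‖1 - h‖ ≤ 1 ∧ ‖h * (1 - h)‖ ≤ 1 / 4 := by
  obtain ⟨x, hx⟩ := hp
  have hsa : IsSelfAdjoint h := hx ▸ .star_mul_self x
  have hspec : ∀ t ∈ spectrum ℝ h, 0 ≤ t ∧ t ≤ 1 := by
    intro t ht
    constructor
    · rw [hx] at ht
      exact spectrum_star_mul_self_nonneg t ht
    · have := norm_apply_le_norm_cfc (fun t : ℝ => t) h ht (by fun_prop)
      rw [cfc_id' ℝ h] at this
      exact (le_abs_self t).trans (this.trans hn)
  have e1 : 1 - h = cfc (fun t : ℝ => 1 - t) h := by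
    rw [cfc_sub (fun _ : ℝ => 1) (fun t => t) h (by fun_prop) (by fun_prop), cfc_id' ℝ h,
      cfc_const_one ℝ h]
  have e2 : h * (1 - h) = cfc (fun t : ℝ => t * (1 - t)) h := by
    rw [cfc_mul (fun t : ℝ => t) (fun t => 1 - t) h (by fun_prop) (by fun_prop), ← e1,
      cfc_id' ℝ h]
  refine ⟨hsa, ?_, ?_⟩
  · rw [e1]
    apply norm_cfc_le zero_le_one
    intro t ht
    have := hspec t ht
    rw [Real.norm_eq_abs, abs_le]; constructor <;> linarith
  · rw [e2]
    apply norm_cfc_le (by norm_num)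
    intro t ht
    have := hspec t ht
    rw [Real.norm_eq_abs, abs_le]; constructor <;> nlinarith [sq_nonneg (t - 1 / 2)]

lemma til_bound {S : NonUnitalStarSubalgebra ℂ A} (he : ∃ e ∈ S, ∀ x ∈ S, e * x = x ∧ x * e = x)
    {x : A} (hx : x ∈ til S) : ∃ s ∈ S, ∃ c : ℂ, x = s + algebraMap ℂ A c ∧ ‖s‖ ≤ 2 * ‖x‖ := by
  obtain ⟨e, heS, he⟩ := he
  obtain ⟨s, hs, c, hx⟩ := hx
  by_cases h1 : e = 1
  · refine ⟨s + algebraMap ℂ A c, ?_, 0, by simp [hx], ?_⟩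
    · rw [Algebra.algebraMap_eq_smul_one, ← h1]
      exact add_mem hs (SMulMemClass.smul_mem _ heS)
    · rw [← hx]; linarith [norm_nonneg x]
  · refine ⟨s, hs, c, hx, ?_⟩
    have hst : star e = e := by
      have h2 := (he (star e) (star_mem heS)).1
      have h3 := congrArg star h2
      rw [star_mul, star_star] at h3
      rw [← h2, h3]
    set f := 1 - e with hf
    have hf0 : f ≠ 0 := fun h => h1 (sub_eq_zero.1 h).symm
    have hff : star f * f = f := by
      rw [hf, star_sub, star_one, hst, mul_sub, sub_mul, sub_mul, (he e heS).1]; simp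
    have hfn : ‖f‖ = 1 := by
      have := CStarRing.norm_star_mul_self (x := f)
      rw [hff] at this
      have h0 : ‖f‖ ≠ 0 := norm_ne_zero_iff.2 hf0
      field_simp at this
      exact this.symm
    have hfx : f * x = c • f := by
      rw [hx, mul_add, hf, sub_mul 1 e s, (he s hs).1, Algebra.algebraMap_eq_smul_one]; simp
    have hc : ‖c‖ ≤ ‖x‖ := by
      have := norm_mul_le f x
      rw [hfx, norm_smul, hfn] at this
      linarith
    have : s = x - algebraMap ℂ A c := by rw [hx]; simp
    rw [this]
    refine (norm_sub_le _ _).trans ?_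
    have h5 : ‖algebraMap ℂ A c‖ ≤ ‖c‖ := by
      rw [Algebra.algebraMap_eq_smul_one, norm_smul]
      exact mul_le_of_le_one_right (norm_nonneg _) norm_one_le_one
    linarith

/-- locally finite-dimensional -/
def LFD (S : NonUnitalStarSubalgebra ℂ A) : Prop :=
  (∃ e ∈ S, ∀ x ∈ S, e * x = x ∧ x * e = x) ∧
  (∀ (Y : Finset A), (↑Y : Set A) ⊆ (S : Set A) → ∀ δ : ℝ, 0 < δ →
    ∃ G : NonUnitalStarSubalgebra ℂ A, G ≤ S ∧ FiniteDimensional ℂ G ∧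
      ∀ y ∈ Y, ∃ s ∈ G, ‖y - s‖ < δ)

/-- a sequence of decompositions -/
structure Dat (X : Finset A) where
  C : ℕ → NonUnitalStarSubalgebra ℂ A
  D : ℕ → NonUnitalStarSubalgebra ℂ A
  E : ℕ → NonUnitalStarSubalgebra ℂ A
  h : ℕ → A
  lC : ∀ j, LFD (C j)
  lD : ∀ j, LFD (D j)
  lE : ∀ j, LFD (E j)
  pos : ∀ j, ∃ x, h j = star x * x
  nrm : ∀ j, ‖h j‖ ≤ 1
  comm : ∀ j, ∀ x ∈ X, ‖h j * x - x * h j‖ < 1 / ((j : ℝ) + 1)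
  hxC : ∀ j, ∀ x ∈ X, ∃ s ∈ C j, ‖h j * x - s‖ < 1 / ((j : ℝ) + 1)
  hxD : ∀ j, ∀ x ∈ X, ∃ s ∈ D j, ‖(1 - h j) * x - s‖ < 1 / ((j : ℝ) + 1)
  hxE : ∀ j, ∀ x ∈ X, ∃ s ∈ E j, ‖h j * ((1 - h j) * x) - s‖ < 1 / ((j : ℝ) + 1)
  EC : ∀ j, ∀ s ∈ E j, ‖s‖ ≤ 1 → ∃ t ∈ C j, ‖s - t‖ < 1 / ((j : ℝ) + 1)
  ED : ∀ j, ∀ s ∈ E j, ‖s‖ ≤ 1 → ∃ t ∈ D j, ‖s - t‖ < 1 / ((j : ℝ) + 1)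
  hE : ∀ j, ∀ s ∈ E j, ‖s‖ ≤ 1 → ∃ t ∈ E j, ‖h j * s - t‖ < 1 / ((j : ℝ) + 1)

lemma scale {E : NonUnitalStarSubalgebra ℂ A} {C : NonUnitalStarSubalgebra ℂ A} {ε : ℝ} {g : A}
    (H : ∀ s ∈ E, ‖s‖ ≤ 1 → ∃ t ∈ C, ‖g * s - t‖ < ε) {c : ℝ} (hc : 0 < c) {s : A} (hs : s ∈ E)
    (hsn : ‖s‖ ≤ c) : ∃ t ∈ C, ‖g * s - t‖ ≤ c * ε := by
  obtain ⟨t, ht, ht'⟩ := H (((c⁻¹ : ℝ) : ℂ) • s) (SMulMemClass.smul_mem _ hs) (by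
    rw [norm_smul, Complex.norm_real, Real.norm_of_nonneg (by positivity)]
    rw [inv_mul_le_iff₀ hc]; linarith)
  refine ⟨(c : ℂ) • t, SMulMemClass.smul_mem _ ht, ?_⟩
  have hc0 : (c : ℂ) ≠ 0 := by exact_mod_cast hc.ne'
  have : g * s - (c : ℂ) • t = (c : ℂ) • (g * (((c⁻¹ : ℝ) : ℂ) • s) - t) := by
    rw [smul_sub, mul_smul_comm, smul_smul]; push_cast; rw [mul_inv_cancel₀ hc0, one_smul]
  rw [this, norm_smul, Complex.norm_real, Real.norm_of_nonneg hc.le]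
  exact mul_le_mul_of_nonneg_left ht'.le hc.le

lemma tends (c : ℝ) : Tendsto (fun j : ℕ => c * (1 / ((j : ℝ) + 1))) atTop (𝓝 0) := by
  have := (tendsto_one_div_add_atTop_nhds_zero_nat (𝕜 := ℝ)).const_mul c
  simpa using this

lemma tends1 : Tendsto (fun j : ℕ => (1 / ((j : ℝ) + 1))) atTop (𝓝 0) :=
  tendsto_one_div_add_atTop_nhds_zero_nat (𝕜 := ℝ)

lemma tl_le_of {E C : ℕ → NonUnitalStarSubalgebra ℂ A} (lE : ∀ j, LFD (E j))
    (EC : ∀ j, ∀ s ∈ E j, ‖s‖ ≤ 1 → ∃ t ∈ C j, ‖s - t‖ < 1 / ((j : ℝ) + 1)) : tl E ≤ tl C := by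
  rintro q ⟨x, hx, hx'⟩
  obtain ⟨c, hc, hcx⟩ := hx.bound
  refine In.of_approx hx (tends (2 * c)) fun j => ?_
  obtain ⟨s, hs, l, hsx, hsn⟩ := til_bound (lE j).1 (hx' j)
  obtain ⟨t, ht, ht'⟩ := scale (g := 1) (c := 2 * c) (by simpa using EC j) (by positivity) hs
    (hsn.trans (by linarith [hcx j]))
  refine ⟨t + algebraMap ℂ A l, ⟨t, ht, l, rfl⟩, ?_⟩
  rw [hsx]
  simpa using ht'

namespace Dat
variable {X : Finset A} (d : Dat X)

lemma bd : d.h ∈ bdd A := ⟨1, d.nrm⟩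

/-- class of h -/
noncomputable def η : SQ A := qmk A ⟨d.h, d.bd⟩

lemma rep : Rep d.h d.η := ⟨d.bd, rfl⟩

/-- class of h(1-h) -/
noncomputable def κ : SQ A := d.η * (1 - d.η)

lemma repκ : Rep (fun j => d.h j * (1 - d.h j)) d.κ := d.rep.mul (Rep.one.sub d.rep)

lemma η_star : star d.η = d.η :=
  d.rep.star.eq d.rep (by simp [(contr_facts (d.pos _) (d.nrm _)).1])

lemma κ_star : star d.κ = d.κ := by
  simp only [κ, star_mul, star_sub, star_one, η_star, mul_sub, sub_mul, mul_one, one_mul]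

lemma anη : AN 1 d.η := ⟨_, d.rep, d.nrm⟩
lemma anη' : AN 1 (1 - d.η) :=
  ⟨_, Rep.one.sub d.rep, fun j => (contr_facts (d.pos j) (d.nrm j)).2.1⟩
lemma anκ : AN (1 / 4) d.κ :=
  ⟨_, d.repκ, fun j => (contr_facts (d.pos j) (d.nrm j)).2.2⟩

lemma η_comm {x : A} (hx : x ∈ X) : d.η * cst x = cst x * d.η :=
  (d.rep.mul (rep_cst x)).eq ((rep_cst x).mul d.rep)
    (squeeze_zero (fun _ => norm_nonneg _) (fun j => (d.comm j x hx).le) tends1)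

lemma η_C {x : A} (hx : x ∈ X) : In d.C (d.η * cst x) :=
  In.of_approx (d.rep.mul (rep_cst x)) tends1 fun j => by
    obtain ⟨s, hs, h⟩ := d.hxC j x hx; exact ⟨s, hs, h.le⟩

lemma η_D {x : A} (hx : x ∈ X) : In d.D ((1 - d.η) * cst x) :=
  In.of_approx ((Rep.one.sub d.rep).mul (rep_cst x)) tends1 fun j => by
    obtain ⟨s, hs, h⟩ := d.hxD j x hx; exact ⟨s, hs, h.le⟩

lemma κ_E {x : A} (hx : x ∈ X) : In d.E (d.κ * cst x) := by
  rw [κ, mul_assoc]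
  exact In.of_approx (d.rep.mul ((Rep.one.sub d.rep).mul (rep_cst x))) tends1 fun j => by
    obtain ⟨s, hs, h⟩ := d.hxE j x hx; exact ⟨s, hs, h.le⟩

lemma η_E {q : SQ A} (hq : In d.E q) : In d.E (d.η * q) := by
  obtain ⟨x, hx, hx'⟩ := hq
  obtain ⟨c, hc, hcx⟩ := hx.bound
  exact In.of_approx (d.rep.mul hx) (tends c) fun j => scale (d.hE j) hc (hx' j) (hcx j)

lemma tlC : tl d.E ≤ tl d.C := tl_le_of d.lE d.EC
lemma tlD : tl d.E ≤ tl d.D := tl_le_of d.lE d.ED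

end Dat

lemma exists_G {E : ℕ → NonUnitalStarSubalgebra ℂ A} (lE : ∀ j, LFD (E j)) {ι : Type*} [Fintype ι]
    (q : ι → SQ A) (hq : ∀ i, In E (q i)) : ∃ G : ℕ → NonUnitalStarSubalgebra ℂ A,
    (∀ j, G j ≤ E j) ∧ (∀ j, FiniteDimensional ℂ (G j)) ∧ ∀ i, In G (q i) := by
  classical
  choose x hx hx' using hq
  have := fun j => (lE j).2 (Finset.univ.image fun i => x i j) (by
      intro y hy
      simp only [Finset.coe_image, Set.mem_image] at hy
      obtain ⟨i, -, rfl⟩ := hy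
      exact hx' i j) (1 / ((j : ℝ) + 1)) (by positivity)
  choose G hG hfd hY using this
  refine ⟨G, hG, hfd, fun i => In.of_approx (hx i) tends1 fun j => ?_⟩
  obtain ⟨s, hs, h⟩ := hY j (x i j) (Finset.mem_image.2 ⟨i, Finset.mem_univ _, rfl⟩)
  exact ⟨s, hs, h.le⟩

/-- Neumann series inside the tilde -/
lemma exists_inv {G : NonUnitalStarSubalgebra ℂ A} [FiniteDimensional ℂ G] {k : A} (hk : k ∈ G)
    (hn : ‖k‖ ≤ 3 / 8) : ∃ r ∈ til G, ‖r‖ ≤ 4 ∧ r * (1 - (k + k)) = 1 ∧ (1 - (k + k)) * r = 1 := by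
  have := til_closed G
  have hc : CompleteSpace (til G) := this.completeSpace_coe
  let k' : til G := ⟨k + k, add_mem (le_til hk) (le_til hk)⟩
  have hk' : ‖k'‖ ≤ 3 / 4 := (norm_add_le k k).trans (by linarith)
  obtain ⟨v, hv⟩ := isUnit_one_sub_of_norm_lt_one (x := k') (by linarith)
  have h1 : ((v⁻¹ : (til G)ˣ) : til G) * (1 - k') = 1 := by rw [← hv]; simp
  have h2 : (1 - k') * ((v⁻¹ : (til G)ˣ) : til G) = 1 := by rw [← hv]; simp
  set r : til G := ((v⁻¹ : (til G)ˣ) : til G)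
  have h1' : (r : A) * (1 - (k + k)) = 1 := congrArg Subtype.val h1
  have h2' : (1 - (k + k)) * (r : A) = 1 := congrArg Subtype.val h2
  refine ⟨r, r.2, ?_, h1', h2'⟩
  have e : (r : A) = 1 + (k + k) * r := by
    rw [sub_mul, one_mul] at h2'
    rw [← h2']; simp
  have : ‖(r : A)‖ ≤ 1 + 3 / 4 * ‖(r : A)‖ := by
    conv_lhs => rw [e]
    refine (norm_add_le _ _).trans (add_le_add norm_one_le_one ((norm_mul_le _ _).trans ?_))
    exact mul_le_mul_of_nonneg_right hk' (norm_nonneg _)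
  linarith

lemma exists_r {X : Finset A} (d : Dat X) {G : ℕ → NonUnitalStarSubalgebra ℂ A}
    (hfd : ∀ j, FiniteDimensional ℂ (G j)) (hκ : In G d.κ) :
    ∃ r ∈ tl G, AN 4 r ∧ r * (1 - (d.κ + d.κ)) = 1 ∧ (1 - (d.κ + d.κ)) * r = 1 := by
  classical
  obtain ⟨k, hk, hk'⟩ := hκ
  have hev := d.anκ.eventually (d := 3 / 8) (by norm_num) hk
  let k₁ : ℕ → A := fun j => if ‖k j‖ ≤ 3 / 8 then k j else 0
  have hk1 : Rep k₁ d.κ := hk.congr (tendsto_of_eventuallyEq (by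
    filter_upwards [hev] with j hj
    simp [k₁, hj]))
  have hk1' : ∀ j, k₁ j ∈ G j ∧ ‖k₁ j‖ ≤ 3 / 8 := by
    intro j
    simp only [k₁]
    split_ifs with h
    · exact ⟨hk' j, h⟩
    · exact ⟨zero_mem _, by norm_num⟩
  have : ∀ j, ∃ r ∈ til (G j), ‖r‖ ≤ 4 ∧ r * (1 - (k₁ j + k₁ j)) = 1 ∧
      (1 - (k₁ j + k₁ j)) * r = 1 := fun j => by
    have := hfd j
    exact exists_inv (hk1' j).1 (hk1' j).2
  choose r hr hr4 h1 h2 using this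
  have hrb : r ∈ bdd A := ⟨4, hr4⟩
  have hrr : Rep r (qmk A ⟨r, hrb⟩) := ⟨hrb, rfl⟩
  refine ⟨_, ⟨r, hrr, hr⟩, ⟨r, hrr, hr4⟩, ?_, ?_⟩
  · exact (hrr.mul (Rep.one.sub (hk1.add hk1))).eq Rep.one (tendsto_of_eventuallyEq (.of_forall h1))
  · exact ((Rep.one.sub (hk1.add hk1)).mul hrr).eq Rep.one (tendsto_of_eventuallyEq (.of_forall h2))

end K1

universe v
namespace K1

lemma comm_lift {M : Type v} [Ring M] (a : Fin 4 → M) (h : ∀ i k, a i * a k = a k * a i) :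
    ∃ (S : Type v) (_ : CommRing S) (φ : S →+* M) (b : Fin 4 → S),
      Function.Injective φ ∧ ∀ i, φ (b i) = a i := by
  let S := Subring.closure (Set.range a)
  let _ : CommRing S := Subring.closureCommRingOfComm (by
    rintro _ ⟨i, rfl⟩ _ ⟨k, rfl⟩
    exact h i k)
  exact ⟨↥S, inferInstance, S.subtype, fun i => ⟨a i, Subring.subset_closure ⟨i, rfl⟩⟩,
    Subtype.val_injective, fun i => rfl⟩

section defs
variable {M : Type v} [Ring M]
/-- entry of W -/
def fa (H R U : M) : M := R * (H * H + (1 - H) * (1 - H) * U)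
/-- entry of W -/
def fb (H R U : M) : M := R * (H * (1 - H)) * (U - 1)
/-- entry of P -/
def ft (H R U V : M) : M := R * R * (H * (1 - H)) * (H * (1 - H)) * (1 + 1 - U - V)
/-- entry of P -/
def fs (H R U V : M) : M := R * R * (H * (1 - H)) *
  (H * H * V - H * H + (1 - H) * (1 - H) - (1 - H) * (1 - H) * U)

/-- the standing hypotheses -/
structure Hyp (H R U V : M) : Prop where
  HU : H * U = U * H
  HV : H * V = V * H
  RH : R * H = H * R
  RU : R * U = U * R
  RV : R * V = V * R
  UV : U * V = 1
  VU : V * U = 1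
  inv : R * (1 - (H * (1 - H) + H * (1 - H))) = 1

lemma Hyp.symm {H R U V : M} (h : Hyp H R U V) : Hyp H R V U :=
  ⟨h.HV, h.HU, h.RH, h.RV, h.RU, h.VU, h.UV, h.inv⟩

lemma Hyp.map {N : Type*} [Ring N] (φ : M →+* N) {H R U V : M} (h : Hyp H R U V) :
    Hyp (φ H) (φ R) (φ U) (φ V) := by
  constructor
  · simpa only [map_mul] using congrArg φ h.HU
  · simpa only [map_mul] using congrArg φ h.HV
  · simpa only [map_mul] using congrArg φ h.RH
  · simpa only [map_mul] using congrArg φ h.RU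
  · simpa only [map_mul] using congrArg φ h.RV
  · simpa only [map_mul, map_one] using congrArg φ h.UV
  · simpa only [map_mul, map_one] using congrArg φ h.VU
  · simpa only [map_mul, map_one, map_sub, map_add] using congrArg φ h.inv

lemma Hyp.lift {H R U V : M} (h : Hyp H R U V) :
    ∃ (S : Type v) (_ : CommRing S) (φ : S →+* M) (H' R' U' V' : S),
      Function.Injective φ ∧ φ H' = H ∧ φ R' = R ∧ φ U' = U ∧ φ V' = V ∧ U' * V' = 1 ∧
        R' * (1 - (H' * (1 - H') + H' * (1 - H'))) = 1 := by
  obtain ⟨S, _, φ, b, hi, hb⟩ := comm_lift ![H, R, U, V] (by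
    have h1 := h.HU; have h2 := h.HV; have h3 := h.RH; have h4 := h.RU; have h5 := h.RV
    have h6 := h.UV; have h7 := h.VU
    intro i k
    fin_cases i <;> fin_cases k <;> simp [*])
  have e0 : φ (b 0) = H := hb 0
  have e1 : φ (b 1) = R := hb 1
  have e2 : φ (b 2) = U := hb 2
  have e3 : φ (b 3) = V := hb 3
  refine ⟨S, _, φ, b 0, b 1, b 2, b 3, hi, e0, e1, e2, e3, hi ?_, hi ?_⟩
  · simp only [map_mul, map_one, e2, e3, h.UV]
  · simp only [map_mul, map_one, map_sub, map_add, e0, e1, h.inv]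

lemma fa_comm {H R U V : M} (h : Hyp H R U V) :
    fa H R U * fb H R U = fb H R U * fa H R U ∧ fa H R U * fb H R V = fb H R V * fa H R U ∧
    fa H R U * fa H R V = fa H R V * fa H R U ∧ fb H R U * fb H R V = fb H R V * fb H R U := by
  obtain ⟨S, _, φ, H, R, U, V, hi, rfl, rfl, rfl, rfl, h1, h2⟩ := h.lift
  simp only [fa, fb]
  try rw [← map_one φ]
  simp only [← map_mul, ← map_sub, ← map_add]
  refine ⟨?_, ?_, ?_, ?_⟩ <;> congr 1 <;> ring

lemma f_ids {H R U V : M} (h : Hyp H R U V) :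
    fa H R U * fa H R V = 1 - ft H R U V ∧ fb H R U * fb H R V = ft H R U V ∧
    fa H R U * fb H R V = fs H R U V ∧ fb H R U * fa H R V = fs H R V U := by
  obtain ⟨S, _, φ, H, R, U, V, hi, rfl, rfl, rfl, rfl, h1, h2⟩ := h.lift
  simp only [fa, fb, ft, fs]
  rw [← map_one φ]
  simp only [← map_mul, ← map_sub, ← map_add]
  refine ⟨?_, ?_, ?_, ?_⟩ <;> congr 1
  · have e : R * (H * H + (1 - H) * (1 - H)) = 1 := by linear_combination h2
    have e2 : (R * (H * H + (1 - H) * (1 - H))) ^ 2 = 1 := by rw [e]; ring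
    linear_combination e2 + R ^ 2 * (1 - H) ^ 4 * h1
  · linear_combination R ^ 2 * (H * (1 - H)) ^ 2 * h1
  · linear_combination R ^ 2 * (H * (1 - H)) * (1 - H) ^ 2 * h1
  · linear_combination R ^ 2 * (H * (1 - H)) * (1 - H) ^ 2 * h1

lemma f_ids2 {H R U V : M} (h : Hyp H R U V) :
    fa H R U = 1 + R * ((1 - H) * (1 - H) * U - (1 - H) * (1 - H)) ∧
    U * fa H R V = 1 + R * (H * H * U - H * H) ∧
    fb H R U = R * (H * (1 - H) * U - H * (1 - H)) ∧
    U * fb H R V = R * (H * (1 - H) - H * (1 - H) * U) := by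
  obtain ⟨S, _, φ, H, R, U, V, hi, rfl, rfl, rfl, rfl, h1, h2⟩ := h.lift
  simp only [fa, fb, ft, fs]
  rw [← map_one φ]
  simp only [← map_mul, ← map_sub, ← map_add]
  refine ⟨?_, ?_, ?_, ?_⟩ <;> congr 1
  · linear_combination h2
  · linear_combination h2 + R * (1 - H) ^ 2 * h1
  · ring
  · linear_combination R * H * (1 - H) * h1

lemma f_one {H R : M} : ft H R 1 1 = 0 ∧ fs H R 1 1 = 0 := by
  constructor
  · simp [ft]
  · simp [fs]
end defs

section blocks
variable {T : Type*} [Ring T] {s : Type*} [Fintype s] [DecidableEq s]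
open Matrix

/-- the rotation -/
def Wm (H R U V : Matrix s s T) : Matrix (s ⊕ s) (s ⊕ s) T :=
  fromBlocks (fa H R U) (-fb H R V) (fb H R U) (fa H R V)
/-- its inverse -/
def Wm' (H R U V : Matrix s s T) : Matrix (s ⊕ s) (s ⊕ s) T :=
  fromBlocks (fa H R V) (fb H R V) (-fb H R U) (fa H R U)
/-- the projection -/
def Pm (H R U V : Matrix s s T) : Matrix (s ⊕ s) (s ⊕ s) T :=
  fromBlocks (1 - ft H R U V) (fs H R U V) (fs H R V U) (ft H R U V)
/-- the base projection -/
def qm (s : Type*) [DecidableEq s] (T : Type*) [Ring T] : Matrix (s ⊕ s) (s ⊕ s) T :=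
  fromBlocks 1 0 0 0

lemma W_W' {H R U V : Matrix s s T} (h : Hyp H R U V) : Wm H R U V * Wm' H R U V = 1 := by
  obtain ⟨c1, c2, c3, c4⟩ := fa_comm h
  obtain ⟨d1, d2, d3, d4⟩ := fa_comm h.symm
  obtain ⟨e1, e2, e3, e4⟩ := f_ids h
  rw [Wm, Wm', fromBlocks_multiply, ← fromBlocks_one]
  congr 1
  · rw [neg_mul_neg, ← c4, e1, e2]; simp
  · rw [neg_mul, c2]; simp
  · rw [mul_neg, d2]; simp
  · rw [d3, e1, e2]; simp

lemma W'_W {H R U V : Matrix s s T} (h : Hyp H R U V) : Wm' H R U V * Wm H R U V = 1 := by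
  obtain ⟨c1, c2, c3, c4⟩ := fa_comm h
  obtain ⟨d1, d2, d3, d4⟩ := fa_comm h.symm
  obtain ⟨e1, e2, e3, e4⟩ := f_ids h
  rw [Wm, Wm', fromBlocks_multiply, ← fromBlocks_one]
  congr 1
  · rw [d3, d4, e1, e2]; simp
  · rw [mul_neg, d1]; simp
  · rw [neg_mul, c1]; simp
  · rw [neg_mul_neg, e1, e2]; simp

lemma WqW' {H R U V : Matrix s s T} (h : Hyp H R U V) :
    Wm H R U V * qm s T * Wm' H R U V = Pm H R U V := by
  obtain ⟨e1, e2, e3, e4⟩ := f_ids h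
  rw [Wm, Wm', Pm, qm, fromBlocks_multiply, fromBlocks_multiply]
  simp [e1, e2, e3, e4]

lemma q_idem : qm s T * qm s T = qm s T := by
  simp [qm, fromBlocks_multiply]

lemma P_idem {H R U V : Matrix s s T} (h : Hyp H R U V) :
    Pm H R U V * Pm H R U V = Pm H R U V := by
  rw [← WqW' h]
  have := W'_W h
  calc _ = Wm H R U V * qm s T * (Wm' H R U V * Wm H R U V) * qm s T * Wm' H R U V := by
        simp only [mul_assoc]
    _ = Wm H R U V * (qm s T * qm s T) * Wm' H R U V := by rw [this]; simp only [mul_assoc, one_mul]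
    _ = _ := by rw [q_idem]

lemma P_one {H R : Matrix s s T} : Pm H R 1 1 = qm s T := by
  simp [Pm, qm, f_one]

lemma W_q {H R U V : Matrix s s T} (h : Hyp H R U V) :
    Wm H R U V * qm s T = Pm H R U V * Wm H R U V := by
  rw [← WqW' h, mul_assoc _ (Wm' H R U V), W'_W h, mul_one]

lemma q_W' {H R U V : Matrix s s T} (h : Hyp H R U V) :
    qm s T * Wm' H R U V = Wm' H R U V * Pm H R U V := by
  rw [← WqW' h, ← mul_assoc, ← mul_assoc, W'_W h, one_mul]

/-- extraction of the diagonal block -/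
lemma block_extract {H R U V : Matrix s s T} (h : Hyp H R U V) {z z' : Matrix (s ⊕ s) (s ⊕ s) T}
    (hz : z * z' = 1) (hz' : z' * z = 1) (hzp : z * Pm H R U V = qm s T * z) :
    (z.toBlocks₁₁ * fa H R U + z.toBlocks₁₂ * fb H R U) *
      (fa H R V * z'.toBlocks₁₁ + fb H R V * z'.toBlocks₂₁) = 1 ∧
    (fa H R V * z'.toBlocks₁₁ + fb H R V * z'.toBlocks₂₁) *
      (z.toBlocks₁₁ * fa H R U + z.toBlocks₁₂ * fb H R U) = 1 := by
  have hzp' : Pm H R U V * z' = z' * qm s T := by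
    calc _ = z' * z * Pm H R U V * z' := by rw [hz', one_mul]
      _ = z' * (z * Pm H R U V) * z' := by simp only [mul_assoc]
      _ = z' * qm s T * (z * z') := by rw [hzp]; simp only [mul_assoc]
      _ = _ := by rw [hz, mul_one]
  set Y := z * Wm H R U V with hY
  set Y' := Wm' H R U V * z' with hY'
  have hYY' : Y * Y' = 1 := by
    calc Y * Y' = z * (Wm H R U V * Wm' H R U V) * z' := by rw [hY, hY']; simp only [mul_assoc]
      _ = 1 := by rw [W_W' h, mul_one, hz]
  have hY'Y : Y' * Y = 1 := by
    calc Y' * Y = Wm' H R U V * (z' * z) * Wm H R U V := by rw [hY, hY']; simp only [mul_assoc]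
      _ = 1 := by rw [hz', mul_one, W'_W h]
  have hYq : Y * qm s T = qm s T * Y := by
    rw [hY, mul_assoc, W_q h, ← mul_assoc, hzp, mul_assoc]
  have hY'q : Y' * qm s T = qm s T * Y' := by
    rw [hY', mul_assoc, ← hzp', ← mul_assoc, ← q_W' h, mul_assoc]
  have key : ∀ N : Matrix (s ⊕ s) (s ⊕ s) T, N * qm s T = qm s T * N →
      N.toBlocks₁₂ = 0 ∧ N.toBlocks₂₁ = 0 := by
    intro N hN
    rw [← fromBlocks_toBlocks N, qm, fromBlocks_multiply, fromBlocks_multiply,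
      fromBlocks_inj] at hN
    obtain ⟨-, h2, h3, -⟩ := hN
    simp only [Matrix.mul_one, Matrix.mul_zero, Matrix.one_mul, Matrix.zero_mul, add_zero] at h2 h3
    exact ⟨h2.symm, h3⟩
  have a1 : Y.toBlocks₁₁ = z.toBlocks₁₁ * fa H R U + z.toBlocks₁₂ * fb H R U := by
    rw [hY, Wm]
    conv_lhs => rw [← fromBlocks_toBlocks z, fromBlocks_multiply, toBlocks_fromBlocks₁₁]
  have a2 : Y'.toBlocks₁₁ = fa H R V * z'.toBlocks₁₁ + fb H R V * z'.toBlocks₂₁ := by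
    rw [hY', Wm']
    conv_lhs => rw [← fromBlocks_toBlocks z', fromBlocks_multiply, toBlocks_fromBlocks₁₁]
  rw [← a1, ← a2]
  obtain ⟨b1, b2⟩ := key Y hYq
  obtain ⟨b3, b4⟩ := key Y' hY'q
  constructor
  · rw [← fromBlocks_toBlocks Y, ← fromBlocks_toBlocks Y', fromBlocks_multiply, b1, b2, b3, b4,
      ← fromBlocks_one, fromBlocks_inj] at hYY'
    simpa using hYY'.1
  · rw [← fromBlocks_toBlocks Y, ← fromBlocks_toBlocks Y', fromBlocks_multiply, b1, b2, b3, b4,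
      ← fromBlocks_one, fromBlocks_inj] at hY'Y
    simpa using hY'Y.1
end blocks

section starP
variable {T : Type*} [Ring T] [StarRing T] {s : Type*} [Fintype s] [DecidableEq s]

lemma f_star {M : Type*} [Ring M] [StarRing M] {H R U V : M} (h : Hyp H R U V) (hH : star H = H)
    (hR : star R = R) (hU : star U = V) (hV : star V = U) :
    star (ft H R U V) = ft H R U V ∧ star (fs H R U V) = fs H R V U := by
  have g : star (fa H R U) = fa H R V ∧ star (fb H R U) = fb H R V ∧
      star (fb H R V) = fb H R U := by
    obtain ⟨S, _, φ, H', R', U', V', hi, e1, e2, e3, e4, h1, h2⟩ := h.lift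
    simp only [fa, fb, star_mul, star_add, star_sub, star_one, hH, hR, hU, hV]
    rw [← map_one φ]
    simp only [← e1, ← e2, ← e3, ← e4, ← map_mul, ← map_sub, ← map_add]
    refine ⟨?_, ?_, ?_⟩ <;> congr 1 <;> ring
  obtain ⟨g1, g2, g3⟩ := g
  obtain ⟨e1, e2, e3, e4⟩ := f_ids h
  rw [← e2, ← e3, ← e4, star_mul, star_mul, g1, g2, g3]
  exact ⟨rfl, rfl⟩

lemma P_star {H R U V : Matrix s s T} (h : Hyp H R U V) (hH : star H = H)
    (hR : star R = R) (hU : star U = V) (hV : star V = U) : star (Pm H R U V) = Pm H R U V := by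
  obtain ⟨h1, h2⟩ := f_star h hH hR hU hV
  obtain ⟨h3, h4⟩ := f_star h.symm hH hR hV hU
  rw [Matrix.star_eq_conjTranspose] at *
  rw [Pm, Matrix.fromBlocks_conjTranspose]
  congr 1
  · rw [← Matrix.star_eq_conjTranspose, star_sub, star_one]
    rw [← Matrix.star_eq_conjTranspose] at h1; rw [h1]
end starP
end K1

namespace K1
open Matrix

section
variable {A : Type u} [CStarAlgebra A] {X : Finset A}

/-- auxiliary finite-dimensional data -/
structure Gd (d : Dat X) where
  G : ℕ → NonUnitalStarSubalgebra ℂ A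
  le : ∀ j, G j ≤ d.E j
  fd : ∀ j, FiniteDimensional ℂ (G j)
  r : SQ A
  rG : r ∈ tl G
  rAN : AN 4 r
  r1 : r * (1 - (d.κ + d.κ)) = 1
  r2 : (1 - (d.κ + d.κ)) * r = 1
  k1 : ∀ x ∈ X, d.κ * cst x ∈ tl G
  k2 : ∀ x ∈ X, d.η * (d.κ * cst x) ∈ tl G
  k3 : ∀ x ∈ X, d.η * (d.η * (d.κ * cst x)) ∈ tl G

lemma exists_Gd (d : Dat X) (h1 : (1 : A) ∈ X) : Nonempty (Gd d) := by
  obtain ⟨G, h2, h3, h4⟩ := exists_G d.lE (ι := Fin 3 × X)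
    (fun i => ![d.κ * cst i.2.1, d.η * (d.κ * cst i.2.1), d.η * (d.η * (d.κ * cst i.2.1))] i.1) (by
      rintro ⟨i, x, hx⟩
      fin_cases i
      · exact d.κ_E hx
      · exact d.η_E (d.κ_E hx)
      · exact d.η_E (d.η_E (d.κ_E hx)))
  have hk : In G d.κ := by simpa using h4 (0, ⟨1, h1⟩)
  obtain ⟨r, a1, a2, a3, a4⟩ := exists_r d h3 hk
  exact ⟨⟨G, h2, h3, r, a1, a2, a3, a4, fun x hx => (h4 (0, ⟨x, hx⟩)).mem_tl,
    fun x hx => (h4 (1, ⟨x, hx⟩)).mem_tl, fun x hx => (h4 (2, ⟨x, hx⟩)).mem_tl⟩⟩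

namespace Gd
variable {d : Dat X} (g : Gd d)

lemma r_comm {y : SQ A} (hy : d.η * y = y * d.η) : g.r * y = y * g.r := by
  have hk : d.κ * y = y * d.κ := by
    rw [Dat.κ]
    have : (1 - d.η) * y = y * (1 - d.η) := by rw [sub_mul, mul_sub, hy, one_mul, mul_one]
    rw [mul_assoc, this, ← mul_assoc, hy, mul_assoc]
  have h1 : (1 - (d.κ + d.κ)) * y = y * (1 - (d.κ + d.κ)) := by
    simp only [sub_mul, mul_sub, add_mul, mul_add, hk, one_mul, mul_one]
  calc g.r * y = g.r * (y * (1 - (d.κ + d.κ))) * g.r := by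
        rw [mul_assoc, mul_assoc, g.r2, mul_one]
    _ = g.r * (1 - (d.κ + d.κ)) * y * g.r := by rw [← h1, ← mul_assoc]
    _ = _ := by rw [g.r1, one_mul]

lemma r_star : star g.r = g.r := by
  have h1 : star g.r * (1 - (d.κ + d.κ)) = 1 := by
    have := congrArg star g.r2
    simpa only [star_mul, star_sub, star_add, star_one, d.κ_star] using this
  calc star g.r = star g.r * (1 - (d.κ + d.κ)) * g.r := by rw [mul_assoc, g.r2, mul_one]
    _ = _ := by rw [h1, one_mul]

variable (s : Type) [Fintype s] [DecidableEq s]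
/-- scalar matrix -/
noncomputable def H : Matrix s s (SQ A) := let _ := g; scalar s d.η
/-- scalar matrix -/
noncomputable def R : Matrix s s (SQ A) := scalar s g.r
variable {s}

lemma H_apply (M : Matrix s s (SQ A)) (a b : s) : (g.H s * M) a b = d.η * M a b := by
  simp [H, diagonal_mul]
lemma R_apply (M : Matrix s s (SQ A)) (a b : s) : (g.R s * M) a b = g.r * M a b := by
  simp [R, diagonal_mul]
lemma H1_apply (M : Matrix s s (SQ A)) (a b : s) : ((1 - g.H s) * M) a b = (1 - d.η) * M a b := by
  rw [sub_mul, sub_mul, Matrix.sub_apply, H_apply, one_mul, one_mul]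

lemma hyp {U V : Matrix s s A} (hU : ∀ a b, U a b ∈ X) (hV : ∀ a b, V a b ∈ X)
    (hUV : U * V = 1) (hVU : V * U = 1) : Hyp (g.H s) (g.R s) (U.map cst) (V.map cst) where
  HU := by
    rw [H, scalar_comm_iff]; ext a b
    simpa using d.η_comm (hU a b)
  HV := by
    rw [H, scalar_comm_iff]; ext a b
    simpa using d.η_comm (hV a b)
  RH := by rw [R, H, ← map_mul, ← map_mul, g.r_comm rfl]
  RU := by
    rw [R, scalar_comm_iff]; ext a b
    simpa using g.r_comm (d.η_comm (hU a b))
  RV := by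
    rw [R, scalar_comm_iff]; ext a b
    simpa using g.r_comm (d.η_comm (hV a b))
  UV := by rw [← Matrix.map_mul, hUV, Matrix.map_one _ (map_zero _) (map_one _)]
  VU := by rw [← Matrix.map_mul, hVU, Matrix.map_one _ (map_zero _) (map_one _)]
  inv := by
    have := congrArg (scalar s) g.r1
    simpa only [Dat.κ, H, R, map_mul, map_sub, map_add, map_one] using this

lemma H_star : star (g.H s) = g.H s := by
  rw [H, scalar_apply, star_eq_conjTranspose, diagonal_conjTranspose]
  congr 1; funext i; exact d.η_star
lemma R_star : star (g.R s) = g.R s := by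
  rw [R, scalar_apply, star_eq_conjTranspose, diagonal_conjTranspose]
  congr 1; funext i; exact g.r_star
lemma star_map (U : Matrix s s A) : star (U.map cst) = (star U).map cst := by
  ext a b; simp [star_apply, star_cst]

/-- projections -/
noncomputable def P (U : Matrix s s A) : Matrix (s ⊕ s) (s ⊕ s) (SQ A) :=
  Pm (g.H s) (g.R s) (U.map cst) ((star U).map cst)

/-- entries in X -/
structure Ok (X : Finset A) (U : Matrix s s A) : Prop where
  m1 : ∀ a b, U a b ∈ X
  m2 : ∀ a b, (star U) a b ∈ X
  u1 : U * star U = 1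
  u2 : star U * U = 1

lemma hyp' {U : Matrix s s A} (h : Ok X U) :
    Hyp (g.H s) (g.R s) (U.map cst) ((star U).map cst) := g.hyp h.m1 h.m2 h.u1 h.u2

lemma P_idem {U : Matrix s s A} (h : Ok X U) : g.P U * g.P U = g.P U := K1.P_idem (g.hyp' h)
lemma P_star {U : Matrix s s A} (h : Ok X U) : star (g.P U) = g.P U :=
  K1.P_star (g.hyp' h) g.H_star g.R_star (star_map U) (by rw [star_map, star_star])
lemma P_one : g.P (1 : Matrix s s A) = qm s (SQ A) := by
  rw [P, star_one, Matrix.map_one _ (map_zero _) (map_one _), K1.P_one]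

lemma R_mem : g.R s ∈ (tl g.G).matrix := by
  intro a b
  rw [R, scalar_apply, diagonal_apply]
  split_ifs
  · exact g.rG
  · exact zero_mem _

section mem
variable {N : Matrix s s A} (hN : ∀ a b, N a b ∈ X)
include hN
lemma m1 : g.H s * (1 - g.H s) * N.map cst ∈ (tl g.G).matrix := by
  intro a b
  rw [mul_assoc, H_apply, H1_apply, ← mul_assoc]
  exact g.k1 _ (hN a b)
lemma m2 : g.H s * (g.H s * (1 - g.H s) * N.map cst) ∈ (tl g.G).matrix := by
  intro a b
  rw [H_apply, mul_assoc, H_apply, H1_apply, ← mul_assoc d.η (1 - _)]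
  exact g.k2 _ (hN a b)
lemma m3 : g.H s * (g.H s * (g.H s * (1 - g.H s) * N.map cst)) ∈ (tl g.G).matrix := by
  intro a b
  rw [H_apply, H_apply, mul_assoc, H_apply, H1_apply, ← mul_assoc d.η (1 - _)]
  exact g.k3 _ (hN a b)
lemma mC : g.H s * g.H s * N.map cst ∈ (tl d.C).matrix := by
  have e : g.H s * g.H s * N.map cst = g.H s * N.map cst - g.H s * (1 - g.H s) * N.map cst := by
    noncomm_ring
  rw [e]
  refine sub_mem ?_ ?_
  · intro a b
    rw [H_apply]
    exact (d.η_C (hN a b)).mem_tl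
  · intro a b
    exact d.tlC (tl_mono g.le (g.m1 hN a b))
lemma mD : (1 - g.H s) * (1 - g.H s) * N.map cst ∈ (tl d.D).matrix := by
  have e : (1 - g.H s) * (1 - g.H s) * N.map cst =
      (1 - g.H s) * N.map cst - g.H s * (1 - g.H s) * N.map cst := by
    noncomm_ring
  rw [e]
  refine sub_mem ?_ ?_
  · intro a b
    rw [H1_apply]
    exact (d.η_D (hN a b)).mem_tl
  · intro a b
    exact d.tlD (tl_mono g.le (g.m1 hN a b))
end mem

lemma GC : tl g.G ≤ tl d.C := (tl_mono g.le).trans d.tlC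
lemma GD : tl g.G ≤ tl d.D := (tl_mono g.le).trans d.tlD

lemma one_mem_X (h0 : (0 : A) ∈ X) (h1 : (1 : A) ∈ X) (a b : s) : (1 : Matrix s s A) a b ∈ X := by
  rw [one_apply]; split_ifs <;> assumption

lemma map_one' : (1 : Matrix s s A).map (cst : A →+* SQ A) = 1 :=
  Matrix.map_one _ (map_zero _) (map_one _)

lemma ft_mem (h0 : (0 : A) ∈ X) (h1 : (1 : A) ∈ X) {U V : Matrix s s A} (hU : ∀ a b, U a b ∈ X)
    (hV : ∀ a b, V a b ∈ X) :
    ft (g.H s) (g.R s) (U.map cst) (V.map cst) ∈ (tl g.G).matrix := by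
  have h : ∀ N : Matrix s s A, (∀ a b, N a b ∈ X) →
      (g.H s * (1 - g.H s)) * (g.H s * (1 - g.H s)) * N.map cst ∈ (tl g.G).matrix := by
    intro N hN
    have e : (g.H s * (1 - g.H s)) * (g.H s * (1 - g.H s)) * N.map cst =
        g.H s * (g.H s * (1 - g.H s) * N.map cst) -
          g.H s * (g.H s * (g.H s * (1 - g.H s) * N.map cst)) := by noncomm_ring
    rw [e]
    exact sub_mem (g.m2 hN) (g.m3 hN)
  have e : ft (g.H s) (g.R s) (U.map cst) (V.map cst) = g.R s * g.R s *
    ((g.H s * (1 - g.H s)) * (g.H s * (1 - g.H s)) * (1 : Matrix s s A).map cst +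
    (g.H s * (1 - g.H s)) * (g.H s * (1 - g.H s)) * (1 : Matrix s s A).map cst -
    (g.H s * (1 - g.H s)) * (g.H s * (1 - g.H s)) * U.map cst -
    (g.H s * (1 - g.H s)) * (g.H s * (1 - g.H s)) * V.map cst) := by
    rw [map_one', ft]
    generalize (1 - g.H s) = J
    simp only [mul_assoc, mul_sub, mul_add, mul_one]
  rw [e]
  have := h _ (one_mem_X h0 h1)
  exact mul_mem (mul_mem g.R_mem g.R_mem) (sub_mem (sub_mem (add_mem this this) (h _ hU)) (h _ hV))

lemma fs_mem (h0 : (0 : A) ∈ X) (h1 : (1 : A) ∈ X) {U V : Matrix s s A} (hU : ∀ a b, U a b ∈ X)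
    (hV : ∀ a b, V a b ∈ X) :
    fs (g.H s) (g.R s) (U.map cst) (V.map cst) ∈ (tl g.G).matrix := by
  have h : ∀ N : Matrix s s A, (∀ a b, N a b ∈ X) →
      (g.H s * (1 - g.H s)) * ((1 - g.H s) * (1 - g.H s)) * N.map cst ∈ (tl g.G).matrix := by
    intro N hN
    have e : (g.H s * (1 - g.H s)) * ((1 - g.H s) * (1 - g.H s)) * N.map cst =
        g.H s * (1 - g.H s) * N.map cst - g.H s * (g.H s * (1 - g.H s) * N.map cst) -
        g.H s * (g.H s * (1 - g.H s) * N.map cst) +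
          g.H s * (g.H s * (g.H s * (1 - g.H s) * N.map cst)) := by noncomm_ring
    rw [e]
    exact add_mem (sub_mem (sub_mem (g.m1 hN) (g.m2 hN)) (g.m2 hN)) (g.m3 hN)
  have h' : ∀ N : Matrix s s A, (∀ a b, N a b ∈ X) →
      (g.H s * (1 - g.H s)) * (g.H s * g.H s) * N.map cst ∈ (tl g.G).matrix := by
    intro N hN
    have e : (g.H s * (1 - g.H s)) * (g.H s * g.H s) * N.map cst =
          g.H s * (g.H s * (g.H s * (1 - g.H s) * N.map cst)) := by noncomm_ring
    rw [e]
    exact g.m3 hN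
  have e : fs (g.H s) (g.R s) (U.map cst) (V.map cst) = g.R s * g.R s *
    ((g.H s * (1 - g.H s)) * (g.H s * g.H s) * V.map cst -
    (g.H s * (1 - g.H s)) * (g.H s * g.H s) * (1 : Matrix s s A).map cst +
    (g.H s * (1 - g.H s)) * ((1 - g.H s) * (1 - g.H s)) * (1 : Matrix s s A).map cst -
    (g.H s * (1 - g.H s)) * ((1 - g.H s) * (1 - g.H s)) * U.map cst) := by
    rw [map_one', fs]
    generalize (1 - g.H s) = J
    simp only [mul_assoc, mul_sub, mul_add, mul_one]
  rw [e]
  have := one_mem_X (s := s) h0 h1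
  exact mul_mem (mul_mem g.R_mem g.R_mem)
    (sub_mem (add_mem (sub_mem (h' _ hV) (h' _ this)) (h _ this)) (h _ hU))

lemma P_mem (h0 : (0 : A) ∈ X) (h1 : (1 : A) ∈ X) {U : Matrix s s A} (h : Ok X U) (a b : s ⊕ s) :
    g.P U a b ∈ tl g.G := by
  have t := g.ft_mem h0 h1 h.m1 h.m2
  have t1 := sub_mem (one_mem (tl g.G).matrix) t
  have t2 := g.fs_mem h0 h1 h.m1 h.m2
  have t3 := g.fs_mem h0 h1 h.m2 h.m1
  rcases a with a | a <;> rcases b with b | b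
  · exact t1 a b
  · exact t2 a b
  · exact t3 a b
  · exact t a b

lemma fa_mem (h0 : (0 : A) ∈ X) (h1 : (1 : A) ∈ X) {U : Matrix s s A} (h : Ok X U) :
    fa (g.H s) (g.R s) (U.map cst) ∈ (tl d.D).matrix ∧
    fb (g.H s) (g.R s) (U.map cst) ∈ (tl d.D).matrix ∧
    U.map cst * fa (g.H s) (g.R s) ((star U).map cst) ∈ (tl d.C).matrix ∧
    U.map cst * fb (g.H s) (g.R s) ((star U).map cst) ∈ (tl d.C).matrix := by
  obtain ⟨e1, e2, e3, e4⟩ := f_ids2 (g.hyp' h)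
  have o := one_mem_X (s := s) h0 h1
  have lC : (tl g.G).matrix (n := s) ≤ (tl d.C).matrix := fun M hM a b => g.GC (hM a b)
  have lD : (tl g.G).matrix (n := s) ≤ (tl d.D).matrix := fun M hM a b => g.GD (hM a b)
  have k1 := g.m1 o
  have k2 := g.mC o
  have k3 := g.mD o
  rw [map_one', mul_one] at k1 k2 k3
  rw [e1, e2, e3, e4]
  refine ⟨?_, ?_, ?_, ?_⟩
  · exact add_mem (one_mem _) (mul_mem (lD g.R_mem) (sub_mem (g.mD h.m1) k3))
  · exact lD (mul_mem g.R_mem (sub_mem (g.m1 h.m1) k1))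
  · exact add_mem (one_mem _) (mul_mem (lC g.R_mem) (sub_mem (g.mC h.m1) k2))
  · exact lC (mul_mem g.R_mem (sub_mem k1 (g.m1 h.m1)))
end Gd
end
end K1

namespace K1
open Matrix Filter Topology

section
variable {A : Type u} [CStarAlgebra A] {X : Finset A}

namespace Gd
variable {d : Dat X} (g : Gd d) {s : Type} [Fintype s] [DecidableEq s]

lemma HK_AN {M : Matrix s s (SQ A)} {c : ℝ} (h : ∀ a b, AN c (M a b)) (a b : s) :
    AN (4 * (4 * (1 / 4 * c))) ((g.R s * (g.R s * (g.H s * ((1 - g.H s) * M)))) a b) := by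
  rw [R_apply, R_apply, H_apply, H1_apply, ← mul_assoc d.η]
  exact g.rAN.mul (g.rAN.mul (d.anκ.mul (h a b)))

lemma P_close {U U' : Matrix s s A} {c : ℝ} (hU : ∀ a b, ‖(U - U') a b‖ ≤ c) (a b : s ⊕ s) :
    AN (8 * c) ((g.P U - g.P U') a b) := by
  have hc : ∀ a b : s, 0 ≤ c := fun a b => (norm_nonneg _).trans (hU a b)
  have key : ∀ (U U' V V' : Matrix s s A), (∀ a b, ‖(U - U') a b‖ ≤ c) →
      (∀ a b, ‖(V - V') a b‖ ≤ c) → ∀ a b,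
      AN (8 * c) ((ft (g.H s) (g.R s) (U.map cst) (V.map cst) -
        ft (g.H s) (g.R s) (U'.map cst) (V'.map cst)) a b) ∧
      AN (8 * c) ((fs (g.H s) (g.R s) (U.map cst) (V.map cst) -
        fs (g.H s) (g.R s) (U'.map cst) (V'.map cst)) a b) := by
    intro U U' V V' hU hV a b
    have hU2 : ∀ a b, AN c ((U.map cst - U'.map cst : Matrix s s (SQ A)) a b) := fun a b => by
      have := AN.cst (hU a b)
      rwa [Matrix.sub_apply, map_sub] at this
    have hV2 : ∀ a b, AN c ((V.map cst - V'.map cst : Matrix s s (SQ A)) a b) := fun a b => by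
      have := AN.cst (hV a b)
      rwa [Matrix.sub_apply, map_sub] at this
    constructor
    · have e : ft (g.H s) (g.R s) (U.map cst) (V.map cst) -
        ft (g.H s) (g.R s) (U'.map cst) (V'.map cst) = g.R s * (g.R s * (g.H s * ((1 - g.H s) *
          (g.H s * ((1 - g.H s) * (-(U.map cst - U'.map cst) - (V.map cst - V'.map cst))))))) := by
        rw [ft, ft]
        generalize (1 - g.H s) = J
        noncomm_ring
      rw [e]
      refine (g.HK_AN (c := 1 / 4 * (c + c)) (fun a b => ?_) a b).mono ?_
      · rw [H_apply, H1_apply, ← mul_assoc]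
        exact d.anκ.mul ((hU2 a b).neg.sub (hV2 a b))
      · linarith [hc a b]
    · have e : fs (g.H s) (g.R s) (U.map cst) (V.map cst) -
        fs (g.H s) (g.R s) (U'.map cst) (V'.map cst) = g.R s * (g.R s * (g.H s * ((1 - g.H s) *
          (g.H s * (g.H s * (V.map cst - V'.map cst)) -
            (1 - g.H s) * ((1 - g.H s) * (U.map cst - U'.map cst)))))) := by
        rw [fs, fs]
        generalize (1 - g.H s) = J
        noncomm_ring
      rw [e]
      refine (g.HK_AN (c := 1 * (1 * c) + 1 * (1 * c)) (fun a b => ?_) a b).mono ?_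
      · rw [Matrix.sub_apply, H_apply, H_apply, H1_apply, H1_apply]
        exact (d.anη.mul (d.anη.mul (hV2 a b))).sub (d.anη'.mul (d.anη'.mul (hU2 a b)))
      · linarith [hc a b]
  have hV : ∀ a b, ‖(star U - star U') a b‖ ≤ c := fun a b => by
    rw [← star_sub, star_apply, norm_star]; exact hU b a
  have k1 := key U U' _ _ hU hV
  have k2 := key _ _ U U' hV hU
  rcases a with a | a <;> rcases b with b | b
  · have := (k1 a b).1.neg
    have e : (g.P U - g.P U') (Sum.inl a) (Sum.inl b) =
      -((ft (g.H s) (g.R s) (U.map cst) ((star U).map cst) -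
        ft (g.H s) (g.R s) (U'.map cst) ((star U').map cst)) a b) := by
      simp [P, Pm]
    rwa [e]
  · exact (k1 a b).2
  · exact (k2 a b).2
  · exact (k1 a b).1
end Gd

section sub
variable {t : Type} [Fintype t] [DecidableEq t]

lemma sub_lift {B : StarSubalgebra ℂ A} {x : Matrix t t A} (h : ∀ a b, x a b ∈ B) :
    ∃ x' : Matrix t t B, x'.map B.subtype = x :=
  ⟨fun a b => ⟨x a b, h a b⟩, rfl⟩

lemma sub_inj {B : StarSubalgebra ℂ A} {x y : Matrix t t B} :
    x.map B.subtype = y.map B.subtype ↔ x = y :=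
  ⟨fun h => by ext a b; exact congrFun (congrFun h a) b, fun h => by rw [h]⟩

lemma sub_star {B : StarSubalgebra ℂ A} (x : Matrix t t B) :
    star (x.map B.subtype) = (star x).map B.subtype := rfl

lemma sub_mul' {B : StarSubalgebra ℂ A} (x y : Matrix t t B) :
    x.map B.subtype * y.map B.subtype = (x * y).map B.subtype := by
  rw [Matrix.map_mul]

lemma sub_one' {B : StarSubalgebra ℂ A} :
    (1 : Matrix t t A) = (1 : Matrix t t B).map B.subtype :=
  (Matrix.map_one _ (map_zero _) (map_one _)).symm

lemma sub_trace {B : StarSubalgebra ℂ A} (x : Matrix t t B) :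
    (x.map B.subtype).trace = B.subtype x.trace := by
  simp [trace]

variable {G : NonUnitalStarSubalgebra ℂ A} [FiniteDimensional ℂ G]

lemma exists_proj_A {x : Matrix t t A} (hm : ∀ a b, x a b ∈ til G) (hx : star x = x) {δ : ℝ}
    (hδ : (Fintype.card t : ℝ) ^ 2 * δ < 1 / 4) (h : ∀ a b, ‖(x * x - x) a b‖ ≤ δ) :
    ∃ p : Matrix t t A, (∀ a b, p a b ∈ til G) ∧ star p = p ∧ p * p = p ∧
      ∀ a b, ‖(p - x) a b‖ ≤ 2 * ((Fintype.card t : ℝ) ^ 2 * δ) := by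
  have : IsClosed (til G : Set A) := til_closed G
  obtain ⟨x, rfl⟩ := sub_lift hm
  rw [sub_star, sub_inj] at hx
  obtain ⟨p, h1, h2, h3⟩ := exists_proj_mat hx hδ (fun a b => by
    have := h a b
    rw [sub_mul'] at this
    exact this)
  exact ⟨p.map (til G).subtype, fun a b => (p a b).2, by rw [sub_star, h1], by rw [sub_mul', h2], h3⟩

lemma trace_close_A {p q : Matrix t t A} (hpm : ∀ a b, p a b ∈ til G) (hqm : ∀ a b, q a b ∈ til G)
    (hp : p * p = p) (hq : q * q = q)
    (hp' : star p = p) (hq' : star q = q) {δ : ℝ} (hδ : (Fintype.card t : ℝ) ^ 2 * δ < 1 / 2)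
    (h : ∀ a b, ‖(p - q) a b‖ ≤ δ)
    (τ : A →ₗ[ℂ] ℂ) (hτ : ∀ x ∈ til G, ∀ y ∈ til G, τ (x * y) = τ (y * x)) :
    τ p.trace = τ q.trace := by
  have : IsClosed (til G : Set A) := til_closed G
  obtain ⟨p, rfl⟩ := sub_lift hpm
  obtain ⟨q, rfl⟩ := sub_lift hqm
  rw [sub_star, sub_inj] at hp' hq'
  rw [sub_mul', sub_inj] at hp hq
  rw [sub_trace, sub_trace]
  exact trace_close_mat hp hq hp' hq' hδ h (τ ∘ₗ (til G).subtype.toAlgHom.toLinearMap)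
    (fun x y => hτ x x.2 y y.2)

lemma compare_A {p q : Matrix t t A} (hpm : ∀ a b, p a b ∈ til G) (hqm : ∀ a b, q a b ∈ til G)
    (hp : p * p = p) (hq : q * q = q) (hp' : star p = p) (hq' : star q = q)
    (h : ∀ τ : A →ₗ[ℂ] ℂ, (∀ x ∈ til G, ∀ y ∈ til G, τ (x * y) = τ (y * x)) →
      τ p.trace = τ q.trace) :
    ∃ z : Matrix t t A, (∀ a b, z a b ∈ til G) ∧ star z * z = 1 ∧ z * star z = 1 ∧ z * p = q * z ∧
      ∀ a b, ‖z a b‖ ≤ 1 := by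
  have : IsClosed (til G : Set A) := til_closed G
  have := til_fd G
  obtain ⟨p, rfl⟩ := sub_lift hpm
  obtain ⟨q, rfl⟩ := sub_lift hqm
  rw [sub_star, sub_inj] at hp' hq'
  rw [sub_mul', sub_inj] at hp hq
  obtain ⟨z, h1, h2, h3, h4⟩ := compare hp hq hp' hq' (by
    intro τ hτ
    obtain ⟨τ', ht⟩ := LinearMap.exists_extend (p := Subalgebra.toSubmodule (til G).toSubalgebra) τ
    have ht' : ∀ x : til G, τ' x = τ x := fun x => LinearMap.congr_fun ht x
    have := h τ' (fun x hx y hy => by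
      have := hτ ⟨x, hx⟩ ⟨y, hy⟩
      rw [← ht', ← ht'] at this
      exact this)
    rw [sub_trace, sub_trace] at this
    rw [← ht', ← ht']
    exact this)
  refine ⟨z.map (til G).subtype, fun a b => (z a b).2, ?_, ?_, ?_, h4⟩
  · rw [sub_star, sub_mul', h1, ← sub_one']
  · rw [sub_star, sub_mul', h2, ← sub_one']
  · rw [sub_mul', sub_mul', h3]
end sub

section mrep
variable {t : Type} [Fintype t] [DecidableEq t]
/-- entrywise representation -/
def MRep (x : ℕ → Matrix t t A) (M : Matrix t t (SQ A)) : Prop :=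
  ∀ a b, Rep (fun j => x j a b) (M a b)

omit [Fintype t] [DecidableEq t] in
lemma MRep.sub {x y : ℕ → Matrix t t A} {M N : Matrix t t (SQ A)} (hx : MRep x M) (hy : MRep y N) :
    MRep (fun j => x j - y j) (M - N) := fun a b => (hx a b).sub (hy a b)
omit [DecidableEq t] in
lemma MRep.mul {x y : ℕ → Matrix t t A} {M N : Matrix t t (SQ A)} (hx : MRep x M) (hy : MRep y N) :
    MRep (fun j => x j * y j) (M * N) := fun a b => by
  simp only [mul_apply]
  exact Rep.sum _ fun i _ => (hx a i).mul (hy i b)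
omit [Fintype t] [DecidableEq t] in
lemma MRep.star {x : ℕ → Matrix t t A} {M : Matrix t t (SQ A)} (hx : MRep x M) :
    MRep (fun j => star (x j)) (star M) := fun a b => (hx b a).star
omit [Fintype t] in
lemma MRep.one : MRep (fun _ => (1 : Matrix t t A)) 1 := fun a b => by
  by_cases h : a = b
  · subst h; simpa using Rep.one
  · simpa [h] using Rep.zero
omit [Fintype t] [DecidableEq t] in
lemma MRep.cst (w : Matrix t t A) : MRep (fun _ => w) (w.map cst) := fun a b => rep_cst _
omit [Fintype t] [DecidableEq t] in
lemma MRep.eq {x y : ℕ → Matrix t t A} {M N : Matrix t t (SQ A)} (hx : MRep x M) (hy : MRep y N)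
    (h : ∀ᶠ j in atTop, x j = y j) : M = N := by
  ext a b
  exact (hx a b).eq (hy a b) (tendsto_of_eventuallyEq (h.mono fun j hj => by rw [hj]))

omit [DecidableEq t] in
lemma MRep.close {x y : ℕ → Matrix t t A} {M N : Matrix t t (SQ A)} (hx : MRep x M)
    (hy : MRep y N) {c e : ℝ} (hce : c < e) (h : ∀ a b, AN c ((M - N) a b)) :
    ∀ᶠ j in atTop, ∀ a b, ‖(x j - y j) a b‖ ≤ e := by
  rw [eventually_all]; intro a
  rw [eventually_all]; intro b
  exact (h a b).eventually hce ((hx.sub hy) a b)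

omit [DecidableEq t] in
lemma MRep.close' {x y : ℕ → Matrix t t A} {M : Matrix t t (SQ A)} (hx : MRep x M)
    (hy : MRep y M) {e : ℝ} (he : 0 < e) :
    ∀ᶠ j in atTop, ∀ a b, ‖(x j - y j) a b‖ ≤ e := by
  refine hx.close hy he fun a b => ?_
  rw [sub_self]
  exact ⟨_, Rep.zero, by simp⟩

lemma lift_proj {G : ℕ → NonUnitalStarSubalgebra ℂ A} (fd : ∀ j, FiniteDimensional ℂ (G j))
    {P : Matrix t t (SQ A)} (hP : ∀ a b, P a b ∈ tl G) (h1 : P * P = P) (h2 : star P = P) :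
    ∃ p : ℕ → Matrix t t A, MRep p P ∧ ∀ j, (∀ a b, p j a b ∈ til (G j)) ∧ p j * p j = p j ∧
      star (p j) = p j := by
  have : ∀ a b, ∃ x : ℕ → A, Rep x (P a b) ∧ ∀ j, x j ∈ til (G j) := fun a b => hP a b
  choose x hx hx' using this
  let y : ℕ → Matrix t t A := fun j => of fun a b => (1 / 2 : ℂ) • (x a b j + star (x b a j))
  have hym : ∀ j a b, y j a b ∈ til (G j) := fun j a b =>
    (til (G j)).smul_mem (add_mem (hx' a b j) (star_mem (hx' b a j))) _
  have hys : ∀ j, star (y j) = y j := by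
    intro j; ext a b
    simp only [y, star_apply, of_apply, star_smul, star_add, star_star]
    rw [add_comm]
    congr 1
    simp
  have hy : MRep y P := by
    intro a b
    refine (hx a b).congr ?_
    have hb : Rep (fun j => star (x b a j)) (P a b) := by
      have := (hx b a).star
      rwa [← star_apply, h2] at this
    have := (hb.tendsto (hx a b)).const_mul (1 / 2)
    rw [mul_zero] at this
    refine this.congr fun j => ?_
    have e : y j a b - x a b j = (1 / 2 : ℂ) • (star (x b a j) - x a b j) := by
      simp only [y, of_apply]
      module
    rw [e, norm_smul]
    norm_num
  have hyy : ∀ a b, Tendsto (fun j => ‖(y j * y j - y j) a b‖) atTop (𝓝 0) := by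
    intro a b
    have := hy.mul hy
    rw [h1] at this
    exact (this a b).tendsto (hy a b)
  let δ : ℕ → ℝ := fun j => ∑ a, ∑ b, ‖(y j * y j - y j) a b‖
  have hδ : Tendsto δ atTop (𝓝 0) := by
    have := tendsto_finsetSum (Finset.univ : Finset t) (fun a _ =>
      tendsto_finsetSum (Finset.univ : Finset t) (fun b _ => hyy a b))
    simp only [Finset.sum_const_zero] at this
    exact this
  have hδ' : ∀ j a b, ‖(y j * y j - y j) a b‖ ≤ δ j := by
    intro j a b
    refine le_trans ?_ (Finset.single_le_sum (f := fun a => ∑ b, ‖(y j * y j - y j) a b‖)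
      (fun i _ => Finset.sum_nonneg fun _ _ => norm_nonneg _) (Finset.mem_univ a))
    exact Finset.single_le_sum (f := fun b => ‖(y j * y j - y j) a b‖)
      (fun i _ => norm_nonneg _) (Finset.mem_univ b)
  have : ∀ j, ∃ p : Matrix t t A, (∀ a b, p a b ∈ til (G j)) ∧ star p = p ∧ p * p = p ∧
      ((Fintype.card t : ℝ) ^ 2 * δ j < 1 / 4 →
      ∀ a b, ‖(p - y j) a b‖ ≤ 2 * ((Fintype.card t : ℝ) ^ 2 * δ j)) := by
    intro j
    have := fd j
    by_cases h : (Fintype.card t : ℝ) ^ 2 * δ j < 1 / 4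
    · obtain ⟨p, a1, a2, a3, a4⟩ := exists_proj_A (hym j) (hys j) h (hδ' j)
      exact ⟨p, a1, a2, a3, fun _ => a4⟩
    · exact ⟨0, fun a b => zero_mem _, star_zero _, by simp, fun h' => absurd h' h⟩
  choose p a1 a2 a3 a4 using this
  refine ⟨p, fun a b => ?_, fun j => ⟨a1 j, a3 j, a2 j⟩⟩
  refine (hy a b).congr ?_
  have t1 : Tendsto (fun j => (Fintype.card t : ℝ) ^ 2 * δ j) atTop (𝓝 0) := by
    simpa using hδ.const_mul ((Fintype.card t : ℝ) ^ 2)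
  have t2 := t1.const_mul 2
  rw [mul_zero] at t2
  refine squeeze_zero' (.of_forall fun _ => norm_nonneg _) ?_ t2
  filter_upwards [t1.eventually_lt_const (show (0 : ℝ) < 1 / 4 by norm_num)] with j hj
  exact a4 j hj a b

/-- tracial functionals eventually agree on nearby lifts -/
lemma trace_chain {G : ℕ → NonUnitalStarSubalgebra ℂ A} (fd : ∀ j, FiniteDimensional ℂ (G j))
    {P Q : Matrix t t (SQ A)} {p q : ℕ → Matrix t t A} (hp : MRep p P) (hq : MRep q Q)
    (hp' : ∀ j, (∀ a b, p j a b ∈ til (G j)) ∧ p j * p j = p j ∧ star (p j) = p j)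
    (hq' : ∀ j, (∀ a b, q j a b ∈ til (G j)) ∧ q j * q j = q j ∧ star (q j) = q j)
    {c δ : ℝ} (hc : c < δ) (hδ : (Fintype.card t : ℝ) ^ 2 * δ < 1 / 2)
    (h : ∀ a b, AN c ((P - Q) a b)) :
    ∀ᶠ j in atTop, ∀ τ : A →ₗ[ℂ] ℂ,
      (∀ x ∈ til (G j), ∀ y ∈ til (G j), τ (x * y) = τ (y * x)) →
      τ (p j).trace = τ (q j).trace := by
  filter_upwards [hp.close hq hc h] with j hj τ hτ
  have := fd j
  exact trace_close_A (hp' j).1 (hq' j).1 (hp' j).2.1 (hq' j).2.1 (hp' j).2.2 (hq' j).2.2 hδ hj τ hτ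
end mrep
end
end K1

namespace K1
open Matrix Filter Topology

section Psi
variable (k : Type) [Fintype k] [DecidableEq k] (n r : ℕ)

/-- reindexing -/
def eqv : (((k ⊕ k) × Fin n) ⊕ (Fin r ⊕ Fin r)) ≃ ((k × Fin n) ⊕ Fin r) ⊕ ((k × Fin n) ⊕ Fin r) :=
  (Equiv.sumCongr (Equiv.sumProdDistrib k k (Fin n)) (Equiv.refl _)).trans
    (Equiv.sumSumSumComm _ _ _ _)
variable {k} 

/-- amplification -/
def Psi {T : Type*} [Ring T] (p : Matrix (k ⊕ k) (k ⊕ k) T) :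
    Matrix (((k × Fin n) ⊕ Fin r) ⊕ ((k × Fin n) ⊕ Fin r))
      (((k × Fin n) ⊕ Fin r) ⊕ ((k × Fin n) ⊕ Fin r)) T :=
  (fromBlocks (blockDiagonal fun _ : Fin n => p) 0 0 (qm (Fin r) T)).submatrix
    (eqv k n r).symm (eqv k n r).symm

variable {T : Type*} [Ring T]

lemma Psi_mul (p q : Matrix (k ⊕ k) (k ⊕ k) T) : Psi n r p * Psi n r q = Psi n r (p * q) := by
  rw [Psi, Psi, submatrix_mul_equiv, fromBlocks_multiply]
  simp only [Matrix.mul_zero, Matrix.zero_mul, add_zero, zero_add, q_idem, ← blockDiagonal_mul]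
  rfl

lemma Psi_star [StarRing T] (p : Matrix (k ⊕ k) (k ⊕ k) T) :
    star (Psi n r p) = Psi n r (star p) := by
  rw [Psi, Psi, star_eq_conjTranspose, conjTranspose_submatrix, fromBlocks_conjTranspose,
    blockDiagonal_conjTranspose]
  simp [qm, fromBlocks_conjTranspose, star_eq_conjTranspose]

lemma Psi_trace (p : Matrix (k ⊕ k) (k ⊕ k) T) :
    (Psi n r p).trace = n • p.trace + (r : T) := by
  have : (Psi n r p).trace = 
    (fromBlocks (blockDiagonal fun _ : Fin n => p) 0 0 (qm (Fin r) T)).trace := by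
    rw [trace, trace, ← Equiv.sum_comp (eqv k n r)]
    simp [Psi]
  rw [this]
  simp [trace, qm, Fintype.sum_prod_type, blockDiagonal_apply, ← Finset.mul_sum, mul_add]

lemma Psi_mem {T' : Type*} [Ring T'] {p : Matrix (k ⊕ k) (k ⊕ k) T} {p' : Matrix (k ⊕ k) (k ⊕ k) T'}
    (F : T → T' → Prop) (h0 : F 0 0) (h1 : F 1 1) (h : ∀ a b, F (p a b) (p' a b)) (a b) :
    F (Psi n r p a b) (Psi n r p' a b) := by
  simp only [Psi, submatrix_apply]
  rcases (eqv k n r).symm a with ⟨a, i⟩ | a | a <;> rcases (eqv k n r).symm b with ⟨b, j⟩ | b | b <;>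
    simp [blockDiagonal_apply, qm, h0, one_apply]
  · split_ifs
    · exact h a b
    · exact h0
  · split_ifs
    · exact h1
    · exact h0

lemma Psi_q : Psi n r (qm k T) = qm ((k × Fin n) ⊕ Fin r) T := by
  ext a b
  rcases a with (⟨a, i⟩ | a) | (⟨a, i⟩ | a) <;> rcases b with (⟨b, j⟩ | b) | (⟨b, j⟩ | b) <;>
    simp [Psi, eqv, qm, blockDiagonal_apply, one_apply]
  split_ifs <;> simp_all
end Psi

section PsiP
variable {A : Type u} [CStarAlgebra A] {X : Finset A} {d : Dat X} (g : Gd d)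
  {k : Type} [Fintype k] [DecidableEq k] (n r : ℕ)

/-- amplification of u -/
def amp (u : Matrix k k A) : Matrix ((k × Fin n) ⊕ Fin r) ((k × Fin n) ⊕ Fin r) A :=
  fromBlocks (blockDiagonal fun _ : Fin n => u) 0 0 1

lemma ft_apply {s : Type} [Fintype s] [DecidableEq s] (U V : Matrix s s (SQ A)) (a b : s) :
    ft (g.H s) (g.R s) U V a b = g.r * (g.r * (d.κ * (d.κ *
      ((1 : Matrix s s (SQ A)) a b + (1 : Matrix s s (SQ A)) a b - U a b - V a b)))) := by
  rw [ft]
  simp only [mul_assoc, Gd.R_apply, Gd.H_apply, Gd.H1_apply, Dat.κ]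
  rfl

lemma fs_apply {s : Type} [Fintype s] [DecidableEq s] (U V : Matrix s s (SQ A)) (a b : s) :
    fs (g.H s) (g.R s) U V a b = g.r * (g.r * (d.κ *
      (d.η * (d.η * V a b) - d.η * (d.η * (1 : Matrix s s (SQ A)) a b) +
        (1 - d.η) * ((1 - d.η) * (1 : Matrix s s (SQ A)) a b) -
        (1 - d.η) * ((1 - d.η) * U a b)))) := by
  rw [fs]
  have e : g.H s * g.H s * V - g.H s * g.H s + (1 - g.H s) * (1 - g.H s) - 
    (1 - g.H s) * (1 - g.H s) * U = g.H s * (g.H s * V) - g.H s * (g.H s * 1) + 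
      (1 - g.H s) * ((1 - g.H s) * 1) - (1 - g.H s) * ((1 - g.H s) * U) := by
    simp only [mul_one, mul_assoc]
  rw [e]
  simp only [mul_assoc, Gd.R_apply, Gd.H_apply, Gd.H1_apply, Dat.κ, Matrix.sub_apply,
    Matrix.add_apply]

lemma amp_star (u : Matrix k k A) : star (amp n r u) = amp n r (star u) := by
  rw [amp, amp, star_eq_conjTranspose, fromBlocks_conjTranspose, blockDiagonal_conjTranspose]
  simp [star_eq_conjTranspose]

lemma P_amp (u : Matrix k k A) : g.P (amp n r u) = Psi n r (g.P u) := by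
  ext a b
  rw [Gd.P, Gd.P, amp_star]
  generalize star u = v
  rcases a with (⟨a, i⟩ | a) | (⟨a, i⟩ | a) <;> rcases b with (⟨b, j⟩ | b) | (⟨b, j⟩ | b) <;>
    simp [Pm, Psi, eqv, qm, amp, blockDiagonal_apply, ft_apply, fs_apply, one_apply]
  all_goals
    by_cases hij : i = j
    · simp [hij]
    · simp [hij]
end PsiP
end K1

namespace K1
open Matrix Filter Topology

section fin
variable {A : Type u} [CStarAlgebra A] {X : Finset A}

lemma exists_Dat (hA : ComplexityRankLeOne A) (X : Finset A) : Nonempty (Dat X) := by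
  have : ∀ j : ℕ, ∃ C D E : NonUnitalStarSubalgebra ℂ A, LFD C ∧ LFD D ∧ LFD E ∧
      ∃ h : A, (∃ x : A, h = star x * x) ∧ ‖h‖ ≤ 1 ∧
        (∀ x ∈ X, ‖h * x - x * h‖ < 1 / ((j : ℝ) + 1)) ∧
        (∀ x ∈ X, ∃ s ∈ C, ‖h * x - s‖ < 1 / ((j : ℝ) + 1)) ∧
        (∀ x ∈ X, ∃ s ∈ D, ‖(1 - h) * x - s‖ < 1 / ((j : ℝ) + 1)) ∧
        (∀ x ∈ X, ∃ s ∈ E, ‖h * ((1 - h) * x) - s‖ < 1 / ((j : ℝ) + 1)) ∧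
        (∀ s ∈ E, ‖s‖ ≤ 1 → ∃ t ∈ C, ‖s - t‖ < 1 / ((j : ℝ) + 1)) ∧
        (∀ s ∈ E, ‖s‖ ≤ 1 → ∃ t ∈ D, ‖s - t‖ < 1 / ((j : ℝ) + 1)) ∧
        (∀ e ∈ E, ‖e‖ ≤ 1 → ∃ t ∈ E, ‖h * e - t‖ < 1 / ((j : ℝ) + 1)) := by
    intro j
    obtain ⟨C, D, E, hC, hD, hE, h, a1, a2, a3, a4, a5, a6, a7, a8, a9⟩ :=
      hA X (1 / ((j : ℝ) + 1)) (by positivity)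
    refine ⟨C, D, E, hC.2, hD.2, hE.2, h, a1, a2, a3, a4, a5, a6, ?_, ?_, a9⟩
    · intro s hs hs1
      obtain ⟨t, ht, -, h'⟩ := a7 s hs hs1
      exact ⟨t, ht, h'⟩
    · intro s hs hs1
      obtain ⟨t, ht, -, h'⟩ := a8 s hs hs1
      exact ⟨t, ht, h'⟩
  choose C D E hC hD hE h a1 a2 a3 a4 a5 a6 a7 a8 a9 using this
  exact ⟨⟨C, D, E, h, hC, hD, hE, a1, a2, a3, a4, a5, a6, a7, a8, a9⟩⟩

lemma partition {t : Type} [Fintype t] (γ : unitInterval → Matrix t t A) (hγ : Continuous γ)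
    {dd : ℝ} (hdd : 0 < dd) : ∃ (N : ℕ) (τ : ℕ → unitInterval), τ 0 = 0 ∧ (∀ i, N ≤ i → τ i = 1) ∧
      ∀ i a b, ‖(γ (τ i) - γ (τ (i + 1))) a b‖ ≤ dd := by
  let f : unitInterval → (t × t → A) := fun x ab => γ x ab.1 ab.2
  have hf : Continuous f := by
    refine continuous_pi fun ab => ?_
    exact (continuous_apply ab.2).comp ((continuous_apply ab.1).comp hγ)
  have hu := CompactSpace.uniformContinuous_of_continuous hf
  rw [Metric.uniformContinuous_iff] at hu
  obtain ⟨δ, hδ, h⟩ := hu dd hdd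
  obtain ⟨N, hN⟩ := exists_nat_one_div_lt hδ
  refine ⟨N + 1, fun i => Set.projIcc 0 1 zero_le_one ((i : ℝ) * (1 / ((N : ℝ) + 1))), ?_, ?_, ?_⟩
  · simp
  · intro i hi
    apply Set.projIcc_of_right_le
    have : ((N : ℝ) + 1) ≤ i := by exact_mod_cast hi
    rw [mul_one_div, le_div_iff₀ (by positivity)]
    linarith
  · intro i a b
    have hd : dist (Set.projIcc (0 : ℝ) 1 zero_le_one ((i : ℝ) * (1 / ((N : ℝ) + 1))))
        (Set.projIcc (0 : ℝ) 1 zero_le_one (((i + 1 : ℕ) : ℝ) * (1 / ((N : ℝ) + 1)))) < δ := by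
      rw [Subtype.dist_eq, Real.dist_eq]
      refine (Set.abs_projIcc_sub_projIcc _).trans_lt ?_
      have : (i : ℝ) * (1 / ((N : ℝ) + 1)) - ((i + 1 : ℕ) : ℝ) * (1 / ((N : ℝ) + 1)) =
        -(1 / ((N : ℝ) + 1)) := by push_cast; ring
      rw [this, abs_neg, abs_of_pos (by positivity)]
      exact hN
    have h2 := (dist_le_pi_dist _ _ (a, b)).trans (h hd).le
    rw [dist_eq_norm] at h2
    exact h2

lemma isUnit_of_two {R : Type*} [Ring R] {x y : R} (h1 : IsUnit (x * y)) (h2 : IsUnit (y * x)) :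
    IsUnit x := by
  obtain ⟨a, ha⟩ := h1.exists_right_inv
  obtain ⟨b, hb⟩ := h2.exists_left_inv
  rw [isUnit_iff_exists_and_exists]
  exact ⟨⟨y * a, by rw [← mul_assoc, ha]⟩, ⟨b * y, by rw [mul_assoc, hb]⟩⟩

lemma ev_unit {t : Type} [Fintype t] [DecidableEq t] {x y : ℕ → Matrix t t A}
    {M N : Matrix t t (SQ A)} (hx : MRep x M) (hy : MRep y N) (h1 : M * N = 1) (h2 : N * M = 1) :
    ∀ᶠ j in atTop, IsUnit (x j) := by
  have k1 := hx.mul hy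
  have k2 := hy.mul hx
  rw [h1] at k1
  rw [h2] at k2
  have hp : (0 : ℝ) < 1 / (2 * ((Fintype.card t : ℝ) ^ 2 + 1)) := by positivity
  have hlt : (Fintype.card t : ℝ) ^ 2 * (1 / (2 * ((Fintype.card t : ℝ) ^ 2 + 1))) < 1 := by
    rw [mul_one_div, div_lt_one (by positivity)]
    nlinarith [sq_nonneg (Fintype.card t : ℝ)]
  filter_upwards [MRep.one.close' k1 hp, MRep.one.close' k2 hp] with j h1 h2
  exact isUnit_of_two (isUnit_mat_of_close hlt h1) (isUnit_mat_of_close hlt h2)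

lemma exists_mrep {t : Type} (M : Matrix t t (SQ A)) : ∃ x : ℕ → Matrix t t A, MRep x M := by
  have : ∀ a b, ∃ x, Rep x (M a b) := fun a b => exists_rep _
  choose x hx using this
  exact ⟨fun j => of fun a b => x a b j, hx⟩

lemma exists_mrep_tl {t : Type} [Fintype t] [DecidableEq t]
    {S : ℕ → NonUnitalStarSubalgebra ℂ A} {M : Matrix t t (SQ A)} (h : M ∈ (tl S).matrix) :
    ∃ x : ℕ → Matrix t t A, MRep x M ∧ ∀ j a b, x j a b ∈ til (S j) := by
  have : ∀ a b, ∃ x, Rep x (M a b) ∧ ∀ j, x j ∈ til (S j) := fun a b => h a b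
  choose x hx hx' using this
  exact ⟨fun j => of fun a b => x a b j, hx, fun j a b => hx' a b j⟩

lemma finish (d : Dat X) {t : Type} [Fintype t] [DecidableEq t] {w : Matrix t t A}
    (hw : star w * w = 1 ∧ w * star w = 1) {x x' c : Matrix t t (SQ A)} (h1 : x * x' = 1)
    (h2 : x' * x = 1) (hc : c = w.map cst * x') (hx : x ∈ (tl d.D).matrix)
    (hcm : c ∈ (tl d.C).matrix) : JoinedIn {y : Matrix t t A | IsUnit y} w 1 := by
  obtain ⟨xj, x1, x2⟩ := exists_mrep_tl hx
  obtain ⟨cj, c1, c2⟩ := exists_mrep_tl hcm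
  obtain ⟨yj, y1⟩ := exists_mrep x'
  have hone : (w.map cst : Matrix t t (SQ A)) * (star w).map cst = 1 := by
    rw [← Matrix.map_mul, hw.2, Matrix.map_one _ (map_zero _) (map_one _)]
  have hone' : ((star w).map cst : Matrix t t (SQ A)) * w.map cst = 1 := by
    rw [← Matrix.map_mul, hw.1, Matrix.map_one _ (map_zero _) (map_one _)]
  have e1 := ev_unit x1 y1 h1 h2
  have e2 := ev_unit c1 (x1.mul (MRep.cst (star w))) (by
      rw [hc]
      calc _ = w.map cst * (x' * x) * (star w).map cst := by simp only [mul_assoc]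
        _ = 1 := by rw [h2, mul_one, hone]) (by
      rw [hc]
      calc _ = x * ((star w).map cst * w.map cst) * x' := by simp only [mul_assoc]
        _ = 1 := by rw [hone', mul_one, h1])
  have hwu : IsUnit w := by
    rw [isUnit_iff_exists_and_exists]
    exact ⟨⟨_, hw.2⟩, ⟨_, hw.1⟩⟩
  obtain ⟨δ, hδ, hcl⟩ := joined_of_close_mat hwu
  have hcx : c * x = w.map cst := by rw [hc, mul_assoc, h2, mul_one]
  have e3 := c1.mul x1
  rw [hcx] at e3
  obtain ⟨j, hj1, hj2, hj3⟩ := (e1.and (e2.and (e3.close' (MRep.cst w) hδ))).exists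
  refine (hcl _ hj3).trans ?_
  have t1 := joined_til (d.lC j).2 hj2 (c2 j)
  have t2 := joined_til (d.lD j).2 hj1 (x2 j)
  have t3 := t1.mul t2
  rw [mul_one] at t3
  refine t3.mono ?_
  rintro _ ⟨a, ha, b, hb, rfl⟩
  exact IsUnit.mul ha hb

lemma nat_chain {G : ℕ → NonUnitalStarSubalgebra ℂ A} {f : ℕ → ℕ → A}
    (h : ∀ i, ∀ᶠ j in atTop, ∀ τ : A →ₗ[ℂ] ℂ,
      (∀ x ∈ til (G j), ∀ y ∈ til (G j), τ (x * y) = τ (y * x)) → τ (f i j) = τ (f (i + 1) j))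
    (i : ℕ) : ∀ᶠ j in atTop, ∀ τ : A →ₗ[ℂ] ℂ,
      (∀ x ∈ til (G j), ∀ y ∈ til (G j), τ (x * y) = τ (y * x)) → τ (f 0 j) = τ (f i j) := by
  induction i with
  | zero => simp
  | succ i ih =>
    filter_upwards [ih, h i] with j h1 h2 τ hτ
    rw [h1 τ hτ, h2 τ hτ]

lemma qm_star {T : Type*} [Ring T] [StarRing T] {s : Type} [DecidableEq s] :
    star (qm s T) = qm s T := by
  rw [qm, star_eq_conjTranspose, fromBlocks_conjTranspose]; simp

lemma qm_entry {T : Type*} [Ring T] {s : Type} [DecidableEq s] (a b : s ⊕ s) :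
    qm s T a b = 0 ∨ qm s T a b = 1 := by
  rcases a with a | a <;> rcases b with b | b <;> simp [qm, one_apply]
  by_cases h : a = b
  · right; exact fun h' => absurd h h'
  · left; exact fun h' => absurd h' h

lemma qm_rep {s : Type} [DecidableEq s] : MRep (fun _ => qm s A) (qm s (SQ A)) := by
  intro a b
  rcases a with a | a <;> rcases b with b | b <;> simp only [qm, fromBlocks_apply₁₁,
    fromBlocks_apply₁₂, fromBlocks_apply₂₁, fromBlocks_apply₂₂]
  · exact MRep.one a b
  all_goals exact Rep.zero

lemma Psi_rep {k : Type} [Fintype k] [DecidableEq k] (n r : ℕ)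
    {q : ℕ → Matrix (k ⊕ k) (k ⊕ k) A} {P : Matrix (k ⊕ k) (k ⊕ k) (SQ A)} (hq : MRep q P) :
    MRep (fun j => Psi n r (q j)) (Psi n r P) := by
  intro a b
  have h := Psi_mem n r (T := ℕ → A) (T' := SQ A) (p := of fun a b j => q j a b) Rep
        Rep.zero Rep.one hq a b
  refine cast (congrArg (fun f => Rep f (Psi n r P a b)) ?_) h
  funext j
  exact Psi_mem n r (T := ℕ → A) (T' := A) (p := of fun a b j => q j a b) (p' := q j)
    (fun f y => f j = y) rfl rfl (fun _ _ => rfl) a b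

lemma core (hA : ComplexityRankLeOne A) {k : Type} [Fintype k] [DecidableEq k]
    (w : Matrix k k A) (hw : star w * w = 1 ∧ w * star w = 1) (n : ℕ) (hn : 1 ≤ n) (r : ℕ)
    (hj : JoinedIn (MatUnitary ((k × Fin n) ⊕ Fin r)) (amp n r w) 1) :
    JoinedIn {y : Matrix k k A | IsUnit y} w 1 := by
  classical
  obtain ⟨γ, hγ⟩ := hj
  let s := (k × Fin n) ⊕ Fin r
  let ct : ℝ := (Fintype.card (s ⊕ s) : ℝ) ^ 2
  let δ : ℝ := 1 / (4 * (ct + 1))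
  have hct : 0 ≤ ct := sq_nonneg _
  have hδ : 0 < δ := by positivity
  have hδ2 : (Fintype.card (s ⊕ s) : ℝ) ^ 2 * δ < 1 / 2 := by
    change ct * (1 / (4 * (ct + 1))) < 1 / 2
    rw [mul_one_div, div_lt_div_iff₀ (by positivity) (by norm_num)]
    nlinarith
  obtain ⟨N, t, t0, t1, ht⟩ := partition (fun x => γ x) γ.continuous (show 0 < δ / 16 by positivity)
  let v : ℕ → Matrix s s A := fun i => γ (t i)
  have v0 : v 0 = amp n r w := by simp [v, t0]
  have vN : ∀ i, N ≤ i → v i = 1 := fun i hi => by simp [v, t1 i hi]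
  have hv : ∀ i, v i * star (v i) = 1 ∧ star (v i) * v i = 1 := fun i => (hγ (t i)).symm
  -- the finite set
  let Xs : Set A := {0, 1} ∪ (Set.range fun ab : k × k => w ab.1 ab.2) ∪
    (Set.range fun ab : k × k => (star w) ab.1 ab.2) ∪
    (Set.range fun q : Fin (N + 1) × s × s => v q.1 q.2.1 q.2.2) ∪
    (Set.range fun q : Fin (N + 1) × s × s => (star (v q.1)) q.2.1 q.2.2)
  have hXs : Xs.Finite := ((((Set.toFinite _).union (Set.finite_range _)).union
    (Set.finite_range _)).union (Set.finite_range _)).union (Set.finite_range _)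
  let X : Finset A := hXs.toFinset
  have hX : ∀ a, a ∈ X ↔ a ∈ Xs := fun a => hXs.mem_toFinset
  have X0 : (0 : A) ∈ X := (hX _).2 (Or.inl (Or.inl (Or.inl (Or.inl (Or.inl rfl)))))
  have X1 : (1 : A) ∈ X := (hX _).2 (Or.inl (Or.inl (Or.inl (Or.inl (Or.inr rfl)))))
  have okw : Gd.Ok X w := ⟨fun a b => (hX _).2 (Or.inl (Or.inl (Or.inl (Or.inr ⟨(a, b), rfl⟩)))),
    fun a b => (hX _).2 (Or.inl (Or.inl (Or.inr ⟨(a, b), rfl⟩))), hw.2, hw.1⟩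
  have okv : ∀ i, Gd.Ok X (v i) := by
    have key : ∀ i, ∃ i' : Fin (N + 1), v i' = v i := by
      intro i
      by_cases hi : i ≤ N
      · exact ⟨⟨i, by omega⟩, rfl⟩
      · exact ⟨⟨N, by omega⟩, by rw [vN i (by omega)]; exact vN N le_rfl⟩
    intro i
    obtain ⟨i', hi'⟩ := key i
    rw [← hi']
    exact ⟨fun a b => (hX _).2 (Or.inl (Or.inr ⟨(i', a, b), rfl⟩)),
      fun a b => (hX _).2 (Or.inr ⟨(i', a, b), rfl⟩), (hv _).1, (hv _).2⟩
  obtain ⟨d⟩ := exists_Dat hA X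
  obtain ⟨g⟩ := exists_Gd d X1
  -- lifts
  have lifts : ∀ i, ∃ p : ℕ → Matrix (s ⊕ s) (s ⊕ s) A, MRep p (g.P (v i)) ∧
      ∀ j, (∀ a b, p j a b ∈ til (g.G j)) ∧ p j * p j = p j ∧ star (p j) = p j := fun i =>
    lift_proj g.fd (g.P_mem X0 X1 (okv i)) (g.P_idem (okv i)) (g.P_star (okv i))
  choose p hp hp' using lifts
  obtain ⟨q, hq, hq'⟩ :=
    lift_proj g.fd (g.P_mem X0 X1 okw) (g.P_idem okw) (g.P_star okw)
  have c1 := nat_chain (G := g.G) (f := fun i j => (p i j).trace) (fun i =>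
    trace_chain g.fd (hp i) (hp (i + 1)) (hp' i) (hp' (i + 1)) (c := 8 * (δ / 16))
      (by linarith) hδ2 (g.P_close (ht i))) N
  have hAN0 : AN 0 (0 : SQ A) := ⟨_, Rep.zero, by simp⟩
  have c0 := trace_chain g.fd (P := g.P (v 0)) (Q := g.P (v 0)) (p := fun j => Psi n r (q j))
    (q := p 0) (by
      rw [v0, P_amp]
      exact Psi_rep n r hq)
    (hp 0) (by
      intro j
      refine ⟨fun a b => ?_, by rw [Psi_mul, (hq' j).2.1], by rw [Psi_star, (hq' j).2.2]⟩
      exact Psi_mem n r (p := q j) (p' := q j) (fun x _ => x ∈ til (g.G j)) (zero_mem _) (one_mem _)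
        (hq' j).1 a b) (hp' 0) hδ hδ2 (by intro a b; rw [sub_self]; exact hAN0)
  have hqm : ∀ (s : Type) [Fintype s] [DecidableEq s], ∀ j : ℕ,
      (∀ a b, qm s A a b ∈ til (g.G j)) ∧ qm s A * qm s A = qm s A ∧
      star (qm s A) = qm s A := by
    intro s _ _ j
    refine ⟨fun a b => ?_, q_idem, qm_star⟩
    rcases qm_entry (T := A) a b with h | h <;> rw [h]
    · exact zero_mem _
    · exact one_mem _
  have c2 := trace_chain g.fd (P := g.P (v N)) (Q := g.P (v N)) (p := p N)
    (q := fun _ => qm s A) (hp N) (by rw [vN N le_rfl, Gd.P_one]; exact qm_rep) (hp' N)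
    (hqm s) hδ hδ2 (by intro a b; rw [sub_self]; exact hAN0)
  have c3 : ∀ᶠ j in atTop, ∀ τ : A →ₗ[ℂ] ℂ,
      (∀ x ∈ til (g.G j), ∀ y ∈ til (g.G j), τ (x * y) = τ (y * x)) →
      τ (q j).trace = τ (qm k A).trace := by
    filter_upwards [c0, c1, c2] with j h0 h1 h2 τ hτ
    have := (h0 τ hτ).trans ((h1 τ hτ).trans (h2 τ hτ))
    rw [← Psi_q, Psi_trace, Psi_trace, map_add, map_add, map_nsmul, map_nsmul] at this
    have := add_right_cancel this
    rw [nsmul_eq_mul, nsmul_eq_mul] at this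
    exact mul_left_cancel₀ (by exact_mod_cast (by omega : n ≠ 0)) this
  have c4 : ∀ j, ∃ z : Matrix (k ⊕ k) (k ⊕ k) A, (∀ a b, z a b ∈ til (g.G j)) ∧ star z * z = 1 ∧
      z * star z = 1 ∧ (∀ a b, ‖z a b‖ ≤ 1) ∧
      ((∀ τ : A →ₗ[ℂ] ℂ,
      (∀ x ∈ til (g.G j), ∀ y ∈ til (g.G j), τ (x * y) = τ (y * x)) →
      τ (q j).trace = τ (qm k A).trace) → z * q j = qm k A * z) := by
    intro j
    have := g.fd j
    by_cases h : ∀ τ : A →ₗ[ℂ] ℂ,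
      (∀ x ∈ til (g.G j), ∀ y ∈ til (g.G j), τ (x * y) = τ (y * x)) →
      τ (q j).trace = τ (qm k A).trace
    · obtain ⟨z, z1, z2, z3, z4, z5⟩ := compare_A (hq' j).1 (hqm k j).1 (hq' j).2.1 (hqm k j).2.1
        (hq' j).2.2 (hqm k j).2.2 h
      exact ⟨z, z1, z2, z3, z5, fun _ => z4⟩
    · refine ⟨1, fun a b => ?_, by simp, by simp, fun a b => ?_, fun h' => absurd h' h⟩
      · rw [one_apply]; split_ifs
        · exact one_mem _
        · exact zero_mem _
      · rw [one_apply]; split_ifs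
        · exact norm_one_le_one
        · simp
  choose z z1 z2 z3 z4 z5 using c4
  let Z : Matrix (k ⊕ k) (k ⊕ k) (SQ A) :=
    of fun a b => qmk A ⟨fun j => z j a b, ⟨1, fun j => z4 j a b⟩⟩
  have hZ : MRep z Z := fun a b => ⟨_, rfl⟩
  have hZm : ∀ a b, Z a b ∈ tl g.G := fun a b => ⟨_, hZ a b, fun j => z1 j a b⟩
  have hZm' : ∀ a b, (star Z) a b ∈ tl g.G := fun a b =>
    ⟨_, hZ.star a b, fun j => star_mem (z1 j b a)⟩
  have hZ1 : Z * star Z = 1 := (hZ.mul hZ.star).eq MRep.one (.of_forall z3)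
  have hZ2 : star Z * Z = 1 := (hZ.star.mul hZ).eq MRep.one (.of_forall z2)
  have hZP : Z * g.P w = qm k (SQ A) * Z := (hZ.mul hq).eq (qm_rep.mul hZ) (c3.mono fun j hj => z5 j hj)
  obtain ⟨b1, b2⟩ := block_extract (g.hyp' okw) hZ1 hZ2 hZP
  obtain ⟨f1, f2, f3, f4⟩ := g.fa_mem X0 X1 okw
  refine finish d hw b1 b2 rfl ?_ ?_
  · exact add_mem (mul_mem (fun a b => g.GD (hZm _ _)) f1) (mul_mem (fun a b => g.GD (hZm _ _)) f2)
  · rw [mul_add, ← mul_assoc, ← mul_assoc]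
    exact add_mem (mul_mem f3 (fun a b => g.GC (hZm' _ _)))
      (mul_mem f4 (fun a b => g.GC (hZm' _ _)))
end fin
end K1

/-- Theorem 4.1 of the paper.  Let `A` be a unital C*-algebra with
complexity rank at most one.  Then `K₁(A)` is torsion-free.  Concretely: for every `m ≥ 1`,
every unitary `u ∈ M_m(A)` and every `n ≥ 1`, if for some `r ≥ 0` the block diagonal unitary
`diag(u, …, u, 1_r) ∈ M_{nm+r}(A)` (with `n` copies of `u`) is connected to the identity by
a continuous path of unitaries, then for some `s ≥ 0` the unitary `diag(u, 1_s) ∈ M_{m+s}(A)`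
is connected to the identity by a continuous path of unitaries.  (Matrix algebras carry the
entrywise topology, which agrees with the topology of the unique C*-norm.) -/
theorem k1_torsionFree_of_complexityRankLeOne {A : Type u} [CStarAlgebra A]
    (hA : ComplexityRankLeOne A)
    (m : ℕ) (hm : 1 ≤ m) (u : Matrix (Fin m) (Fin m) A)
    (hu : star u * u = 1 ∧ u * star u = 1)
    (n : ℕ) (hn : 1 ≤ n)
    (htors : ∃ r : ℕ,
      JoinedIn (MatUnitary ((Fin m × Fin n) ⊕ Fin r))
        (Matrix.fromBlocks (Matrix.blockDiagonal fun _ : Fin n => u) 0 0 1) 1) :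
    ∃ s : ℕ,
      JoinedIn (MatUnitary (Fin m ⊕ Fin s))
        (Matrix.fromBlocks u 0 0 1) 1 := by
  obtain ⟨r, hr⟩ := htors
  have h1 := K1.core hA u hu n hn r hr
  have h2 := K1.joined_unitary_mat hu.1 h1
  have h3 := h2.map (f := fun y : Matrix (Fin m) (Fin m) A =>
    (Matrix.fromBlocks y 0 0 1 : Matrix (Fin m ⊕ Fin 0) (Fin m ⊕ Fin 0) A))
    (Continuous.matrix_fromBlocks continuous_id continuous_const continuous_const continuous_const)
  rw [Matrix.fromBlocks_one] at h3
  refine ⟨0, h3.mono ?_⟩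
  rintro _ ⟨y, ⟨hy1, hy2⟩, rfl⟩
  constructor
  · simp [Matrix.star_eq_conjTranspose, Matrix.fromBlocks_conjTranspose,
      Matrix.fromBlocks_multiply] at hy1 ⊢
    rw [hy1, Matrix.fromBlocks_one]
  · simp [Matrix.star_eq_conjTranspose, Matrix.fromBlocks_conjTranspose,
      Matrix.fromBlocks_multiply] at hy2 ⊢
    rw [hy2, Matrix.fromBlocks_one]
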